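/- arXiv:0902.2188 — 7 statements merged into one kernel-verified Lean document; each statement's English description precedes it below -/
import Mathlib

section
/- For every real number u > 0, ∫₀^1 [1/(1-y) + 1/log y] · y^{u-1} dy = log u - ψ(u), where ψ is the digamma function (Binet's integral). -/
open Set in
theorem binetKernel_mem_Icc {y : ℝ} (hy : y ∈ Ioc (0 : ℝ) 1) :
    1 / (1 - y) + 1 / Real.log y ∈ Icc (0 : ℝ) 1 := by
  obtain ⟨h0, h1⟩ := hy
  rcases h1.eq_or_lt with rfl | h1
  · simp
  have hl : Real.log y < 0 := Real.log_neg h0 h1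
  have hup : Real.log y ≤ y - 1 := Real.log_le_sub_one_of_pos h0
  have hlow : 1 - y⁻¹ ≤ Real.log y := Real.one_sub_inv_le_log_of_pos h0
  have hy1 : 0 < 1 - y := by linarith
  have hlow' : y - 1 ≤ y * Real.log y := by
    have := mul_le_mul_of_nonneg_left hlow h0.le
    rwa [mul_sub, mul_inv_cancel₀ h0.ne', mul_one] at this
  have key : 1 / (1 - y) + 1 / Real.log y
      = (1 - y + Real.log y) / ((1 - y) * Real.log y) := by
    field_simp [hl.ne]
    ring
  have hneg : (1 - y) * Real.log y < 0 := mul_neg_of_pos_of_neg hy1 hl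
  rw [key]
  refine ⟨div_nonneg_of_nonpos (by linarith) hneg.le, ?_⟩
  rw [div_le_one_of_neg hneg]
  linarith

open Set MeasureTheory in
theorem integrableOn_rpow_sub_one {u : ℝ} (hu : 0 < u) :
    IntegrableOn (fun y : ℝ => y ^ (u - 1)) (Ioc 0 1) :=
  (intervalIntegrable_iff_integrableOn_Ioc_of_le zero_le_one).1
    (intervalIntegral.intervalIntegrable_rpow' (by linarith))

open Set MeasureTheory in
theorem integral_rpow_sub_one {u : ℝ} (hu : 0 < u) :
    ∫ y in Ioc (0 : ℝ) 1, y ^ (u - 1) = 1 / u := by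
  rw [← intervalIntegral.integral_of_le zero_le_one, integral_rpow (Or.inl (by linarith))]
  simp [hu.ne']

open Set MeasureTheory in
theorem integrableOn_binetKernel_mul_rpow {u : ℝ} (hu : 0 < u) :
    IntegrableOn (fun y : ℝ => (1 / (1 - y) + 1 / Real.log y) * y ^ (u - 1)) (Ioc 0 1) := by
  refine (integrableOn_rpow_sub_one hu).mono' (by fun_prop) ?_
  refine (ae_restrict_iff' measurableSet_Ioc).2 (Filter.Eventually.of_forall fun y hy => ?_)
  have hk := binetKernel_mem_Icc hy
  have hp : 0 ≤ y ^ (u - 1) := Real.rpow_nonneg hy.1.le _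
  rw [Real.norm_of_nonneg (mul_nonneg hk.1 hp)]
  exact mul_le_of_le_one_left hp hk.2

open Set MeasureTheory in
theorem integral_binetKernel_mul_rpow_mem_Icc {u : ℝ} (hu : 0 < u) :
    ∫ y in Ioc (0 : ℝ) 1, (1 / (1 - y) + 1 / Real.log y) * y ^ (u - 1) ∈ Icc 0 (1 / u) := by
  constructor
  · exact setIntegral_nonneg measurableSet_Ioc fun y hy =>
      mul_nonneg (binetKernel_mem_Icc hy).1 (Real.rpow_nonneg hy.1.le _)
  · rw [← integral_rpow_sub_one hu]
    exact setIntegral_mono_on (integrableOn_binetKernel_mul_rpow hu)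
      (integrableOn_rpow_sub_one hu) measurableSet_Ioc fun y hy =>
      mul_le_of_le_one_left (Real.rpow_nonneg hy.1.le _) (binetKernel_mem_Icc hy).2

open Set MeasureTheory in
theorem integrable_prod_rpow_sub_one {u : ℝ} (hu : 0 < u) :
    Integrable (Function.uncurry fun y t : ℝ => y ^ (t - 1))
      ((volume.restrict (Ioc 0 1)).prod (volume.restrict (Ioc u (u + 1)))) := by
  have hdom : Integrable (fun z : ℝ × ℝ => z.1 ^ (u - 1))
      ((volume.restrict (Ioc 0 1)).prod (volume.restrict (Ioc u (u + 1)))) :=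
    Integrable.comp_fst (integrableOn_rpow_sub_one hu) _
  refine hdom.mono' ?_ ?_
  · exact Measurable.aestronglyMeasurable (by unfold Function.uncurry; fun_prop)
  · rw [Measure.prod_restrict]
    refine (ae_restrict_iff' (measurableSet_Ioc.prod measurableSet_Ioc)).2
      (Filter.Eventually.of_forall fun z hz => ?_)
    obtain ⟨hy, ht⟩ := hz
    simp only [Function.uncurry]
    rw [Real.norm_of_nonneg (Real.rpow_nonneg hy.1.le _)]
    exact Real.rpow_le_rpow_of_exponent_ge hy.1 hy.2 (by linarith [ht.1])

open Set MeasureTheory in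
theorem integral_integral_rpow_sub_one {u : ℝ} (hu : 0 < u) :
    ∫ y in Ioc (0 : ℝ) 1, ∫ t in Ioc u (u + 1), y ^ (t - 1)
      = Real.log (u + 1) - Real.log u := by
  rw [integral_integral_swap (integrable_prod_rpow_sub_one hu)]
  rw [setIntegral_congr_fun (g := fun t : ℝ => 1 / t) measurableSet_Ioc
    fun t ht => integral_rpow_sub_one (hu.trans ht.1)]
  rw [← intervalIntegral.integral_of_le (by linarith), integral_one_div_of_pos hu (by linarith),
    Real.log_div (by linarith) hu.ne']

open Set MeasureTheory in
theorem integral_rpow_exponent {y : ℝ} (hy : 0 < y) (hy1 : y ≠ 1) (u : ℝ) :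
    ∫ t in Ioc u (u + 1), y ^ (t - 1) = (y ^ u - y ^ (u - 1)) / Real.log y := by
  have hl : Real.log y ≠ 0 := Real.log_ne_zero_of_pos_of_ne_one hy hy1
  rw [← intervalIntegral.integral_of_le (by linarith)]
  have hd : ∀ t ∈ uIcc u (u + 1),
      HasDerivAt (fun t : ℝ => y ^ (t - 1) / Real.log y) (y ^ (t - 1)) t := by
    intro t _
    have h := ((((hasDerivAt_id t).sub_const 1).const_rpow hy).div_const (Real.log y))
    rwa [mul_one, mul_div_cancel_left₀ _ hl] at h
  rw [intervalIntegral.integral_eq_sub_of_hasDerivAt hd]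
  · rw [add_sub_cancel_right, sub_div]
  · refine Continuous.intervalIntegrable ?_ _ _
    exact Continuous.rpow continuous_const (by fun_prop) fun _ => Or.inl hy.ne'

open Set MeasureTheory in
theorem integral_binetKernel_sub_succ {u : ℝ} (hu : 0 < u) :
    (∫ y in Ioc (0 : ℝ) 1, (1 / (1 - y) + 1 / Real.log y) * y ^ (u - 1))
      - ∫ y in Ioc (0 : ℝ) 1, (1 / (1 - y) + 1 / Real.log y) * y ^ (u + 1 - 1)
      = 1 / u - (Real.log (u + 1) - Real.log u) := by
  have hint : IntegrableOn (fun y : ℝ => ∫ t in Ioc u (u + 1), y ^ (t - 1)) (Ioc 0 1) :=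
    (integrable_prod_rpow_sub_one hu).integral_prod_left
  rw [← integral_sub (integrableOn_binetKernel_mul_rpow hu)
    (integrableOn_binetKernel_mul_rpow (by linarith)), ← integral_rpow_sub_one hu,
    ← integral_integral_rpow_sub_one hu, ← integral_sub (integrableOn_rpow_sub_one hu) hint]
  refine setIntegral_congr_fun measurableSet_Ioc fun y hy => ?_
  rcases hy.2.eq_or_lt with rfl | h1
  · simp
  have hl : Real.log y ≠ 0 := (Real.log_neg hy.1 h1).ne
  have h1' : 1 - y ≠ 0 := by linarith
  have hpow : y ^ u = y ^ (u - 1) * y := by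
    rw [← Real.rpow_add_one hy.1.ne', sub_add_cancel]
  rw [integral_rpow_exponent hy.1 h1.ne, add_sub_cancel_right, hpow]
  field_simp
  ring

theorem deriv_Gamma_add_one_div {u : ℝ} (hu : 0 < u) :
    deriv Real.Gamma (u + 1) / Real.Gamma (u + 1)
      = deriv Real.Gamma u / Real.Gamma u + 1 / u := by
  have hG : Real.Gamma u ≠ 0 := (Real.Gamma_pos_of_pos hu).ne'
  have hd : ∀ {x : ℝ}, 0 < x → HasDerivAt Real.Gamma (deriv Real.Gamma x) x := fun hx =>
    (Real.differentiableOn_Gamma_Ioi.differentiableAt (Ioi_mem_nhds hx)).hasDerivAt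
  have h1 : HasDerivAt (fun x => Real.Gamma (x + 1)) (deriv Real.Gamma (u + 1)) u :=
    (hd (by linarith : 0 < u + 1)).comp_add_const u 1
  have h2 : HasDerivAt (fun x => x * Real.Gamma x)
      (1 * Real.Gamma u + u * deriv Real.Gamma u) u := (hasDerivAt_id u).mul (hd hu)
  have h3 := h1.congr_of_eventuallyEq (f₁ := fun x => x * Real.Gamma x) <| by
    filter_upwards [Ioi_mem_nhds hu] with x hx
    exact (Real.Gamma_add_one (ne_of_gt hx)).symm
  rw [← h2.unique h3, Real.Gamma_add_one hu.ne']
  field_simp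
  ring

open Set in
theorem log_sub_deriv_Gamma_div_mem_Icc {u : ℝ} (hu : 0 < u) :
    Real.log u - deriv Real.Gamma u / Real.Gamma u ∈ Icc 0 (1 / u) := by
  have hu1 : 0 < u + 1 := by linarith
  have hd : ∀ {x : ℝ}, 0 < x → HasDerivAt (Real.log ∘ Real.Gamma)
      (deriv Real.Gamma x / Real.Gamma x) x := fun {x} hx =>
    ((Real.differentiableOn_Gamma_Ioi.differentiableAt (Ioi_mem_nhds hx)).hasDerivAt).log
      (Real.Gamma_pos_of_pos hx).ne'
  have hslope : slope (Real.log ∘ Real.Gamma) u (u + 1) = Real.log u := by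
    simp only [slope_def_field, Function.comp, add_sub_cancel_left, div_one]
    rw [Real.Gamma_add_one hu.ne', Real.log_mul hu.ne' (Real.Gamma_pos_of_pos hu).ne']
    ring
  have h1 := Real.convexOn_log_Gamma.le_slope_of_hasDerivAt (mem_Ioi.2 hu) (mem_Ioi.2 hu1)
    (lt_add_one u) (hd hu)
  have h2 := Real.convexOn_log_Gamma.slope_le_of_hasDerivAt (mem_Ioi.2 hu) (mem_Ioi.2 hu1)
    (lt_add_one u) (hd hu1)
  rw [hslope] at h1 h2
  rw [deriv_Gamma_add_one_div hu] at h2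
  constructor <;> linarith

/-- A function on `(0, ∞)` that is invariant under `x ↦ x + 1` and bounded by `1 / x` vanishes. -/
theorem eq_zero_of_periodic_of_abs_le {f : ℝ → ℝ} (hper : ∀ x, 0 < x → f (x + 1) = f x)
    (hbd : ∀ x, 0 < x → |f x| ≤ 1 / x) {u : ℝ} (hu : 0 < u) : f u = 0 := by
  have hn : ∀ n : ℕ, f (u + n) = f u := by
    intro n
    induction n with
    | zero => simp
    | succ n ih => rw [← ih, ← hper (u + n) (by positivity)]; push_cast; ring_nf
  by_contra hne
  have hpos : 0 < |f u| := abs_pos.2 hne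
  obtain ⟨n, hlt⟩ := exists_nat_gt (1 / |f u|)
  have hb := hbd (u + n) (by positivity)
  rw [hn, le_div_iff₀ (by positivity)] at hb
  rw [div_lt_iff₀ hpos] at hlt
  nlinarith

theorem stmt_4 (u : ℝ) (hu : 0 < u) :
    ∫ y in (0 : ℝ)..1, (1 / (1 - y) + 1 / Real.log y) * y ^ (u - 1) =
      Real.log u - deriv Real.Gamma u / Real.Gamma u := by
  rw [intervalIntegral.integral_of_le zero_le_one, ← sub_eq_zero]
  refine eq_zero_of_periodic_of_abs_le
    (f := fun x => (∫ y in Set.Ioc (0 : ℝ) 1, (1 / (1 - y) + 1 / Real.log y) * y ^ (x - 1))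
      - (Real.log x - deriv Real.Gamma x / Real.Gamma x)) (fun x hx => ?_) (fun x hx => ?_) hu
  · have h := integral_binetKernel_sub_succ hx
    have h' := deriv_Gamma_add_one_div hx
    linarith
  · have h := integral_binetKernel_mul_rpow_mem_Icc hx
    have h' := log_sub_deriv_Gamma_div_mem_Icc hx
    exact abs_sub_le_of_nonneg_of_le h.1 h.2 h'.1 h'.2
end

section
/- The Euler–Mascheroni constant γ satisfies γ = ∫₀^1 [1/(1-y) + 1/log y] dy. -/
open Real

open MeasureTheory Set Filter Topology

/-- For `0 < y < 1`, the function `1 / (1 - y) + 1 / log y` takes values in `[0, 1]`. -/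
lemma one_div_one_sub_add_one_div_log_mem_Icc {y : ℝ} (h0 : 0 < y) (h1 : y < 1) :
    1 / (1 - y) + 1 / Real.log y ∈ Icc (0 : ℝ) 1 := by
  have hl : Real.log y < 0 := Real.log_neg h0 h1
  have hs : 0 < 1 - y := by linarith
  have hupper : Real.log y ≤ y - 1 := Real.log_le_sub_one_of_pos h0
  have hlower : y - 1 ≤ y * Real.log y := by
    have h := mul_le_mul_of_nonneg_left (Real.one_sub_inv_le_log_of_pos h0) h0.le
    rwa [mul_sub, mul_inv_cancel₀ h0.ne', mul_one] at h
  have heq : 1 / (1 - y) + 1 / Real.log y =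
      (-Real.log y - (1 - y)) / ((1 - y) * -Real.log y) := by
    field_simp [hl.ne]
    ring
  have hpos : 0 < (1 - y) * -Real.log y := mul_pos hs (by linarith)
  rw [heq]
  refine ⟨div_nonneg (by linarith) hpos.le, (div_le_one hpos).2 (by nlinarith)⟩

lemma integral_const_rpow_zero_left {y : ℝ} (h0 : 0 < y) (h1 : y < 1) (a : ℝ) :
    ∫ t in (0 : ℝ)..a, y ^ t = (y ^ a - 1) / Real.log y := by
  have hl : Real.log y ≠ 0 := (Real.log_neg h0 h1).ne
  have hd : ∀ t ∈ uIcc 0 a, HasDerivAt (fun t : ℝ => y ^ t / Real.log y) (y ^ t) t := by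
    intro t _
    have h := (Real.hasStrictDerivAt_const_rpow h0 t).hasDerivAt.div_const (Real.log y)
    rwa [mul_div_cancel_right₀ _ hl] at h
  rw [intervalIntegral.integral_eq_sub_of_hasDerivAt hd
    (Continuous.intervalIntegrable (Real.continuous_const_rpow h0.ne') _ _), Real.rpow_zero, sub_div]

lemma integrableOn_uncurry_rpow (n : ℕ) :
    IntegrableOn (Function.uncurry fun y t : ℝ => y ^ t) (uIoc (0 : ℝ) 1 ×ˢ uIoc (0 : ℝ) n) := by
  rw [uIoc_of_le zero_le_one, uIoc_of_le n.cast_nonneg]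
  refine Measure.integrableOn_of_bounded (M := 1) ?_ ?_ ?_
  · rw [Measure.volume_eq_prod, Measure.prod_prod]
    simp
  · exact (measurable_fst.pow measurable_snd).aestronglyMeasurable
  · filter_upwards [ae_restrict_mem (measurableSet_Ioc.prod measurableSet_Ioc)] with p hp
    obtain ⟨⟨h0, h1⟩, h2, -⟩ := hp
    rw [Function.uncurry, Real.norm_of_nonneg (Real.rpow_nonneg h0.le _)]
    exact Real.rpow_le_one h0.le h1 h2.le

lemma integral_integral_rpow (n : ℕ) :
    ∫ y in (0 : ℝ)..1, ∫ t in (0 : ℝ)..n, y ^ t = Real.log (n + 1) := by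
  rw [intervalIntegral_intervalIntegral_swap (integrableOn_uncurry_rpow n)]
  have hinner : EqOn (fun t : ℝ => ∫ y in (0 : ℝ)..1, y ^ t) (fun t => (t + 1)⁻¹)
      (uIcc 0 n) := by
    intro t ht
    rw [uIcc_of_le n.cast_nonneg] at ht
    have ht1 : t + 1 ≠ 0 := by linarith [ht.1]
    simp [integral_rpow (Or.inl (by linarith [ht.1] : -1 < t)), Real.zero_rpow ht1]
  rw [intervalIntegral.integral_congr hinner,
    intervalIntegral.integral_comp_add_right (fun t : ℝ => t⁻¹),
    integral_inv_of_pos (by norm_num) (by positivity)]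
  simp

theorem stmt_5 :
    Real.eulerMascheroniConstant =
      ∫ y in (0 : ℝ)..1, (1 / (1 - y) + 1 / Real.log y) := by
  set f : ℝ → ℝ := fun y => 1 / (1 - y) + 1 / Real.log y with hf
  have hae : ∀ᵐ y ∂(volume.restrict (uIoc (0 : ℝ) 1)), y ∈ Ioo (0 : ℝ) 1 := by
    rw [uIoc_of_le zero_le_one, ← restrict_Ioo_eq_restrict_Ioc]
    exact ae_restrict_mem measurableSet_Ioo
  have hmeas : Measurable f := by fun_prop
  have hint : ∀ n : ℕ, IntervalIntegrable (fun y => f y * y ^ n) volume 0 1 := by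
    intro n
    rw [intervalIntegrable_iff]
    refine Measure.integrableOn_of_bounded (M := 1) (by simp) (by fun_prop) ?_
    filter_upwards [hae] with y hy
    obtain ⟨h0, h1⟩ := one_div_one_sub_add_one_div_log_mem_Icc hy.1 hy.2
    rw [Real.norm_of_nonneg (mul_nonneg h0 (pow_nonneg hy.1.le n))]
    exact mul_le_one₀ h1 (pow_nonneg hy.1.le n) (pow_le_one₀ hy.1.le hy.2.le)
  have hdecomp (n : ℕ) : ∫ y in (0 : ℝ)..1, f y =
      (∫ y in (0 : ℝ)..1, f y * y ^ n) + Real.eulerMascheroniSeq n := by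
    have hsum : ∫ y in (0 : ℝ)..1, ∑ i ∈ Finset.range n, y ^ i = (harmonic n : ℝ) := by
      rw [intervalIntegral.integral_finsetSum fun i _ => (continuous_pow i).intervalIntegrable _ _]
      simp [harmonic]
    have hsumint : IntervalIntegrable (fun y : ℝ => ∑ i ∈ Finset.range n, y ^ i) volume 0 1 :=
      Continuous.intervalIntegrable (by fun_prop) _ _
    have hlogint : IntervalIntegrable (fun y : ℝ => ∫ t in (0 : ℝ)..n, y ^ t) volume 0 1 := by
      have h := integrableOn_uncurry_rpow n
      rw [IntegrableOn, Measure.volume_eq_prod, ← Measure.prod_restrict] at h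
      rw [intervalIntegrable_iff]
      simpa [IntegrableOn, intervalIntegral.integral_of_le, uIoc_of_le] using h.integral_prod_left
    rw [Real.eulerMascheroniSeq, ← hsum, ← integral_integral_rpow,
      ← intervalIntegral.integral_sub hsumint hlogint,
      ← intervalIntegral.integral_add (hint n) (hsumint.sub hlogint)]
    refine intervalIntegral.integral_congr_ae_restrict ?_
    filter_upwards [hae] with y hy
    have hl : Real.log y ≠ 0 := (Real.log_neg hy.1 hy.2).ne
    have hs : 1 - y ≠ 0 := (sub_pos.2 hy.2).ne'
    have hgeom : ∑ i ∈ Finset.range n, y ^ i = (1 - y ^ n) / (1 - y) := by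
      rw [eq_div_iff hs, geom_sum_mul_neg]
    rw [integral_const_rpow_zero_left hy.1 hy.2, Real.rpow_natCast, hgeom, hf]
    field_simp
    ring
  have hbound (n : ℕ) : (∫ y in (0 : ℝ)..1, f y * y ^ n) ∈ Icc (0 : ℝ) (1 / (n + 1)) := by
    constructor
    · refine intervalIntegral.integral_nonneg_of_ae_restrict zero_le_one ?_
      rw [restrict_Ioo_eq_restrict_Icc.symm]
      filter_upwards [ae_restrict_mem measurableSet_Ioo] with y hy
      exact mul_nonneg (one_div_one_sub_add_one_div_log_mem_Icc hy.1 hy.2).1 (pow_nonneg hy.1.le n)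
    · calc _ ≤ ∫ y in (0 : ℝ)..1, y ^ n := by
            refine intervalIntegral.integral_mono_on_of_le_Ioo zero_le_one (hint n)
              ((continuous_pow n).intervalIntegrable _ _) fun y hy => ?_
            exact mul_le_of_le_one_left (pow_nonneg hy.1.le n)
              (one_div_one_sub_add_one_div_log_mem_Icc hy.1 hy.2).2
        _ = 1 / (n + 1) := by simp
  have hzero : Tendsto (fun n : ℕ => ∫ y in (0 : ℝ)..1, f y * y ^ n) atTop (𝓝 0) :=
    squeeze_zero (fun n => (hbound n).1) (fun n => (hbound n).2)
      tendsto_one_div_add_atTop_nhds_zero_nat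
  have hlim := hzero.add Real.tendsto_eulerMascheroniSeq
  simp only [← hdecomp, zero_add] at hlim
  exact tendsto_nhds_unique hlim tendsto_const_nhds
end

section
/- For every real number t > 0, ∫₀^∞ [1/(e^x - 1) - 1/x] · (1 - e^{-t x})/x dx = t·log t - t - log Γ(1 + t), a Binet-type integral representation for log Γ. -/
open Real MeasureTheory

open Set Filter Topology

lemma one_sub_exp_neg_mul_div_nonneg {t x : ℝ} (ht : 0 < t) (hx : 0 < x) :
    0 ≤ (1 - exp (-t * x)) / x := by
  have : exp (-t * x) ≤ 1 := exp_le_one_iff.mpr (by nlinarith [mul_pos ht hx])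
  exact div_nonneg (by linarith) hx.le

lemma one_sub_exp_neg_mul_div_le {t x : ℝ} (hx : 0 < x) : (1 - exp (-t * x)) / x ≤ t := by
  rw [div_le_iff₀ hx]
  linarith [add_one_le_exp (-t * x)]

lemma one_sub_exp_neg_mul_div_le_inv {t x : ℝ} (hx : 0 < x) : (1 - exp (-t * x)) / x ≤ 1 / x := by
  gcongr
  linarith [exp_pos (-t * x)]

lemma exp_sub_one_pos {x : ℝ} (hx : 0 < x) : 0 < exp x - 1 := by
  linarith [add_one_lt_exp hx.ne']

lemma one_div_exp_sub_one_le {x : ℝ} (hx : 0 < x) : 1 / (exp x - 1) ≤ 1 / x :=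
  one_div_le_one_div_of_le hx (by linarith [add_one_le_exp x])

lemma one_div_sub_one_div_exp_sub_one_le_one {x : ℝ} (hx : 0 < x) :
    1 / x - 1 / (exp x - 1) ≤ 1 := by
  have hE := exp_sub_one_pos hx
  rw [div_sub_div _ _ hx.ne' hE.ne', div_le_one (by positivity)]
  have h1 := add_one_le_exp (-x)
  have h2 : exp x * exp (-x) = 1 := by rw [← exp_add]; simp
  nlinarith [exp_pos x]

lemma integrableOn_binet (t : ℝ) (ht : 0 < t) :
    IntegrableOn (fun x : ℝ ↦ (1 / (exp x - 1) - 1 / x) * ((1 - exp (-t * x)) / x)) (Ioi 0) := by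
  refine Integrable.mono' (g := fun x ↦ (t + 1) * (1 + x ^ 2)⁻¹)
    ((integrable_inv_one_add_sq.const_mul _).integrableOn)
    (Measurable.aestronglyMeasurable (by fun_prop)) ?_
  filter_upwards [self_mem_ae_restrict measurableSet_Ioi] with x hx
  have hx : 0 < x := hx
  have ha0 := one_div_exp_sub_one_le hx
  have ha1 := one_div_sub_one_div_exp_sub_one_le_one hx
  have ha2 : 1 / x - 1 / (exp x - 1) ≤ 1 / x := by
    linarith [one_div_pos.mpr (exp_sub_one_pos hx)]
  have hb0 := one_sub_exp_neg_mul_div_nonneg ht hx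
  have hb1 := one_sub_exp_neg_mul_div_le (t := t) hx
  have hb2 := one_sub_exp_neg_mul_div_le_inv (t := t) hx
  rw [norm_mul, norm_eq_abs, norm_eq_abs, abs_of_nonneg hb0, abs_of_nonpos (by linarith), neg_sub]
  have h1 := mul_le_mul ha1 hb1 hb0 zero_le_one
  have h2 := mul_le_mul ha2 hb2 hb0 (by positivity)
  rw [← div_eq_mul_inv, le_div_iff₀ (by positivity)]
  have h3 : 1 / x * (1 / x) * x ^ 2 = 1 := by field_simp
  nlinarith [mul_le_mul_of_nonneg_right h2 (sq_nonneg x)]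

lemma integrableOn_exp_sub_exp_div {a b : ℝ} (ha : 0 < a) (hb : 0 < b) :
    IntegrableOn (fun x : ℝ ↦ (exp (-a * x) - exp (-b * x)) / x) (Ioi 0) := by
  have hint {c : ℝ} (hc : 0 < c) : IntegrableOn (fun x : ℝ ↦ exp (-c * x)) (Ioi 0) :=
    exp_neg_integrableOn_Ioi 0 hc
  refine Integrable.mono' (((hint ha).add (hint hb)).const_mul |b - a|)
    (Measurable.aestronglyMeasurable (by fun_prop)) ?_
  filter_upwards [self_mem_ae_restrict measurableSet_Ioi] with x hx
  have hx : 0 < x := hx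
  have key (c d : ℝ) : (exp (-c * x) - exp (-d * x)) / x ≤
      |d - c| * (exp (-c * x) + exp (-d * x)) := by
    have h1 : exp (-d * x) = exp (-c * x) * exp ((c - d) * x) := by rw [← exp_add]; ring_nf
    have h2 := mul_le_mul_of_nonneg_left (add_one_le_exp ((c - d) * x)) (exp_pos (-c * x)).le
    rw [div_le_iff₀ hx]
    calc exp (-c * x) - exp (-d * x) ≤ (d - c) * (exp (-c * x) * x) := by linarith
      _ ≤ |d - c| * (exp (-c * x) * x) := by gcongr; exact le_abs_self _
      _ ≤ |d - c| * (exp (-c * x) + exp (-d * x)) * x := by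
        rw [mul_assoc]
        gcongr
        linarith [exp_pos (-d * x)]
  rw [norm_eq_abs, abs_le']
  refine ⟨key a b, ?_⟩
  rw [← neg_div, neg_sub, abs_sub_comm, Pi.add_apply, add_comm]
  exact key b a

lemma integral_exp_sub_exp_div {a b : ℝ} (ha : 0 < a) (hb : 0 < b) :
    ∫ x in Ioi (0 : ℝ), (exp (-a * x) - exp (-b * x)) / x = log (b / a) := by
  have heq (x : ℝ) : (exp (-a * x) - exp (-b * x)) / x =
      x⁻¹ • (exp (-(a * x)) - exp (-(b * x))) := by
    rw [smul_eq_mul, div_eq_inv_mul, neg_mul, neg_mul]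
  have hcont : Continuous fun x : ℝ ↦ exp (-x) := by fun_prop
  have h0 : Tendsto (fun x : ℝ ↦ exp (-x)) (𝓝[>] 0) (𝓝 1) :=
    (hcont.tendsto' 0 1 (by simp)).mono_left nhdsWithin_le_nhds
  have hint := integrableOn_exp_sub_exp_div ha hb
  simp_rw [heq] at hint ⊢
  simpa using Frullani.integral_Ioi_eq (hcont.locallyIntegrable.locallyIntegrableOn _) ha hb h0
    tendsto_exp_neg_atTop_nhds_zero hint

lemma hasDerivAt_one_sub_exp_neg_mul_div (t : ℝ) {x : ℝ} (hx : 0 < x) :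
    HasDerivAt (fun y : ℝ ↦ (1 - exp (-t * y)) / y)
      (t * exp (-t * x) / x - (1 - exp (-t * x)) / x ^ 2) x := by
  have h1 : HasDerivAt (fun y : ℝ ↦ 1 - exp (-t * y)) (-(exp (-t * x) * (-t))) x :=
    (((hasDerivAt_id' x).const_mul (-t)).exp.const_sub 1).congr_deriv (by ring)
  refine (h1.div (hasDerivAt_id' x) hx.ne').congr_deriv ?_
  field_simp

lemma tendsto_one_sub_exp_neg_mul_div_zero (t : ℝ) :
    Tendsto (fun y : ℝ ↦ (1 - exp (-t * y)) / y) (𝓝[>] 0) (𝓝 t) := by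
  have h1 : HasDerivAt (fun y : ℝ ↦ 1 - exp (-t * y)) t 0 :=
    (((hasDerivAt_id' (0 : ℝ)).const_mul (-t)).exp.const_sub 1).congr_deriv (by simp)
  have := h1.tendsto_slope_zero_right
  simpa [div_eq_inv_mul] using this

lemma tendsto_one_sub_exp_neg_mul_div_atTop {t : ℝ} (ht : 0 < t) :
    Tendsto (fun y : ℝ ↦ (1 - exp (-t * y)) / y) atTop (𝓝 0) := by
  refine tendsto_of_tendsto_of_tendsto_of_le_of_le' tendsto_const_nhds
    (tendsto_inv_atTop_zero (𝕜 := ℝ)) ?_ ?_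
  · filter_upwards [eventually_gt_atTop 0] with x hx using one_sub_exp_neg_mul_div_nonneg ht hx
  · filter_upwards [eventually_gt_atTop 0] with x hx
    simpa using one_sub_exp_neg_mul_div_le_inv (t := t) hx

lemma integrableOn_integral_deriv_one_sub_exp_neg_mul_div {t : ℝ} (ht : 0 < t) :
    IntegrableOn (fun x : ℝ ↦ t * exp (-t * x) / x - (1 - exp (-t * x)) / x ^ 2) (Ioi 0) ∧
    ∫ x in Ioi (0 : ℝ), (t * exp (-t * x) / x - (1 - exp (-t * x)) / x ^ 2) = -t := by
  set h : ℝ → ℝ := fun y ↦ (1 - exp (-t * y)) / y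
  have hcont : ContinuousWithinAt (Function.update h 0 t) (Ici 0) 0 := by
    rw [continuousWithinAt_update_same, Ici_sdiff_left]
    exact tendsto_one_sub_exp_neg_mul_div_zero t
  have heq {x : ℝ} (hx : 0 < x) : Function.update h 0 t =ᶠ[𝓝 x] h := by
    filter_upwards [eventually_ne_nhds hx.ne'] with y hy using Function.update_of_ne hy _ _
  have hderiv : ∀ x ∈ Ioi (0 : ℝ), HasDerivAt (Function.update h 0 t)
      (t * exp (-t * x) / x - (1 - exp (-t * x)) / x ^ 2) x := fun x hx ↦
    (hasDerivAt_one_sub_exp_neg_mul_div t hx).congr_of_eventuallyEq (heq hx)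
  have hlim : Tendsto (Function.update h 0 t) atTop (𝓝 0) := by
    refine (tendsto_one_sub_exp_neg_mul_div_atTop ht).congr' ?_
    filter_upwards [eventually_gt_atTop 0] with x hx using (Function.update_of_ne hx.ne' _ _).symm
  have hneg : ∀ x ∈ Ioi (0 : ℝ),
      t * exp (-t * x) / x - (1 - exp (-t * x)) / x ^ 2 ≤ 0 := by
    intro x hx
    have hx : 0 < x := hx
    have h1 := mul_le_mul_of_nonneg_left (add_one_le_exp (t * x)) (exp_pos (-t * x)).le
    have h2 : exp (-t * x) * exp (t * x) = 1 := by rw [← exp_add]; simp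
    have h3 : t * exp (-t * x) / x - (1 - exp (-t * x)) / x ^ 2 =
        (t * exp (-t * x) * x - (1 - exp (-t * x))) / x ^ 2 := by field_simp
    rw [h3]
    exact div_nonpos_of_nonpos_of_nonneg (by linarith) (by positivity)
  refine ⟨integrableOn_Ioi_deriv_of_nonpos hcont hderiv hneg hlim, ?_⟩
  simpa using integral_Ioi_of_hasDerivAt_of_nonpos hcont hderiv hneg hlim

/-- The integrand of Malmsten's formula for `log Γ(1 + t)`. -/
noncomputable def malmstenIntegrand (t x : ℝ) : ℝ :=
  (t * exp (-x) - (1 - exp (-t * x)) / (exp x - 1)) / x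

lemma malmstenIntegrand_eq (t : ℝ) {x : ℝ} (hx : 0 < x) :
    malmstenIntegrand t x =
      (t * exp (-t * x) / x - (1 - exp (-t * x)) / x ^ 2) +
        t * ((exp (-1 * x) - exp (-t * x)) / x) -
        (1 / (exp x - 1) - 1 / x) * ((1 - exp (-t * x)) / x) := by
  have := (exp_sub_one_pos hx).ne'
  rw [malmstenIntegrand, neg_one_mul]
  field_simp
  ring

lemma integrableOn_malmstenIntegrand {t : ℝ} (ht : 0 < t) :
    IntegrableOn (malmstenIntegrand t) (Ioi 0) :=
  (((integrableOn_integral_deriv_one_sub_exp_neg_mul_div ht).1.add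
    ((integrableOn_exp_sub_exp_div one_pos ht).const_mul t)).sub
    (integrableOn_binet t ht)).congr_fun
    (fun _ hx ↦ (malmstenIntegrand_eq t hx).symm) measurableSet_Ioi

lemma integral_malmstenIntegrand_eq {t : ℝ} (ht : 0 < t) :
    ∫ x in Ioi (0 : ℝ), malmstenIntegrand t x = -t + t * log t -
      ∫ x in Ioi (0 : ℝ), (1 / (exp x - 1) - 1 / x) * ((1 - exp (-t * x)) / x) := by
  obtain ⟨hD, hD'⟩ := integrableOn_integral_deriv_one_sub_exp_neg_mul_div ht
  have hK := (integrableOn_exp_sub_exp_div one_pos ht).const_mul t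
  rw [setIntegral_congr_fun measurableSet_Ioi (fun x hx ↦ malmstenIntegrand_eq t hx),
    integral_sub (by exact hD.add hK) (integrableOn_binet t ht), integral_add hD hK, hD',
    integral_const_mul, integral_exp_sub_exp_div one_pos ht, div_one]

lemma convexOn_malmstenIntegrand {x : ℝ} (hx : 0 < x) :
    ConvexOn ℝ (Ioi 0) fun t ↦ malmstenIntegrand t x := by
  refine ⟨convex_Ioi 0, fun s _ t _ a b ha hb hab ↦ ?_⟩
  have hE := exp_sub_one_pos hx
  have h := convexOn_exp.2 (mem_univ (-s * x)) (mem_univ (-t * x)) ha hb hab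
  simp only [smul_eq_mul] at h ⊢
  have h1 : -(a * s + b * t) * x = a * (-s * x) + b * (-t * x) := by ring
  have h2 : a * malmstenIntegrand s x + b * malmstenIntegrand t x =
      ((a * s + b * t) * exp (-x) -
        ((a + b) - (a * exp (-s * x) + b * exp (-t * x))) / (exp x - 1)) / x := by
    simp only [malmstenIntegrand]
    field_simp
    ring
  rw [h2, malmstenIntegrand, h1, hab]
  gcongr

lemma convexOn_integral_malmstenIntegrand :
    ConvexOn ℝ (Ioi 0) fun t ↦ ∫ x in Ioi (0 : ℝ), malmstenIntegrand t x := by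
  refine ⟨convex_Ioi 0, fun s hs t ht a b ha hb hab ↦ ?_⟩
  have hst := convex_Ioi (0 : ℝ) hs ht ha hb hab
  have his := (integrableOn_malmstenIntegrand hs).const_mul a
  have hit := (integrableOn_malmstenIntegrand ht).const_mul b
  simp only [smul_eq_mul] at hst ⊢
  rw [← integral_const_mul, ← integral_const_mul, ← integral_add his hit]
  exact setIntegral_mono_on (integrableOn_malmstenIntegrand hst) (his.add hit) measurableSet_Ioi
    fun x hx ↦ (convexOn_malmstenIntegrand hx).2 hs ht ha hb hab

lemma malmstenIntegrand_one {x : ℝ} (hx : 0 < x) : malmstenIntegrand 1 x = 0 := by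
  have hE := (exp_sub_one_pos hx).ne'
  rw [malmstenIntegrand, neg_one_mul, exp_neg]
  field_simp
  simp

lemma malmstenIntegrand_add_one (t : ℝ) {x : ℝ} (hx : 0 < x) :
    malmstenIntegrand (t + 1) x =
      malmstenIntegrand t x + (exp (-1 * x) - exp (-(t + 1) * x)) / x := by
  have hE := (exp_sub_one_pos hx).ne'
  have h : exp (-t * x) = exp (-(t + 1) * x) * exp x := by rw [← exp_add]; ring_nf
  rw [malmstenIntegrand, malmstenIntegrand, h, neg_one_mul]
  field_simp
  ring

lemma integral_malmstenIntegrand_add_one {t : ℝ} (ht : 0 < t) :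
    ∫ x in Ioi (0 : ℝ), malmstenIntegrand (t + 1) x =
      (∫ x in Ioi (0 : ℝ), malmstenIntegrand t x) + log (t + 1) := by
  have ht' : 0 < t + 1 := by linarith
  rw [setIntegral_congr_fun measurableSet_Ioi (fun x hx ↦ malmstenIntegrand_add_one t hx),
    integral_add (integrableOn_malmstenIntegrand ht) (integrableOn_exp_sub_exp_div one_pos ht'),
    integral_exp_sub_exp_div one_pos ht', div_one]

/-- **Malmsten's formula** for the logarithm of the Gamma function. -/
theorem integral_malmstenIntegrand {t : ℝ} (ht : 0 < t) :
    ∫ x in Ioi (0 : ℝ), malmstenIntegrand t x = log (Gamma (1 + t)) := by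
  set f : ℝ → ℝ := fun s ↦ (∫ x in Ioi (0 : ℝ), malmstenIntegrand s x) - log s with hf
  have hconv : ConvexOn ℝ (Ioi 0) f :=
    convexOn_integral_malmstenIntegrand.sub strictConcaveOn_log_Ioi.concaveOn
  have hfeq {y : ℝ} (hy : 0 < y) : f (y + 1) = f y + log y := by
    simp only [hf, integral_malmstenIntegrand_add_one hy]
    ring
  have hone : f 1 = 0 := by
    simp only [hf, log_one, sub_zero]
    exact setIntegral_eq_zero_of_forall_eq_zero fun x hx ↦ malmstenIntegrand_one hx
  have hlim := BohrMollerup.tendsto_logGammaSeq hconv hfeq ht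
  have h := tendsto_nhds_unique hlim (BohrMollerup.tendsto_log_gamma ht)
  rw [add_comm, Gamma_add_one ht.ne', log_mul ht.ne' (Gamma_pos_of_pos ht).ne', ← h, hone]
  simp [hf]

theorem stmt_7 (t : ℝ) (ht : 0 < t) :
    ∫ x in Set.Ioi (0 : ℝ),
        (1 / (Real.exp x - 1) - 1 / x) * ((1 - Real.exp (-t * x)) / x) =
      t * Real.log t - t - Real.log (Real.Gamma (1 + t)) := by
  linarith [integral_malmstenIntegrand_eq ht, integral_malmstenIntegrand ht]
end

section
/- For every real number t > 0, ∫₀^∞ [1/(e^x - 1) - 1/x] · (e^{-x} - e^{-t x})/x dx = t·log t - t + 1 - log Γ(1 + t). -/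
open Real MeasureTheory

/-- The kernel `1 / (exp x - 1) - 1 / x` of Binet's first formula. -/
noncomputable def binetKernel (x : ℝ) : ℝ := 1 / (Real.exp x - 1) - 1 / x

lemma measurable_binetKernel : Measurable binetKernel := by
  unfold binetKernel
  fun_prop

lemma abs_binetKernel_le_one {x : ℝ} (hx : 0 < x) : |binetKernel x| ≤ 1 := by
  have h1 : x < Real.exp x - 1 := by linarith [Real.add_one_lt_exp hx.ne']
  have h0 : 0 < Real.exp x - 1 := hx.trans h1
  unfold binetKernel
  rw [abs_le]
  constructor
  · have h2 : Real.exp x * (1 - x) ≤ 1 := by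
      have h3 : 1 - x ≤ Real.exp (-x) := by linarith [Real.add_one_le_exp (-x)]
      calc Real.exp x * (1 - x) ≤ Real.exp x * Real.exp (-x) := by gcongr
        _ = 1 := by rw [← Real.exp_add]; simp
    rw [div_sub_div _ _ h0.ne' hx.ne', le_div_iff₀ (by positivity)]
    nlinarith
  · have h2 : 1 / (Real.exp x - 1) ≤ 1 / x := one_div_le_one_div_of_le hx h1.le
    linarith

lemma abs_exp_neg_mul_sub_le (a b : ℝ) {x : ℝ} (hx : 0 < x) :
    |(Real.exp (-a * x) - Real.exp (-b * x)) / x| ≤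
      |a - b| * (Real.exp (-a * x) + Real.exp (-b * x)) := by
  have key : ∀ u v : ℝ, Real.exp u - Real.exp v ≤ |u - v| * (Real.exp u + Real.exp v) := by
    intro u v
    have h1 : Real.exp v = Real.exp u * Real.exp (v - u) := by rw [← Real.exp_add]; ring_nf
    have h2 := Real.add_one_le_exp (v - u)
    have h3 : Real.exp u - Real.exp v ≤ (u - v) * Real.exp u := by
      rw [h1]; nlinarith [Real.exp_pos u]
    have h4 := mul_le_mul_of_nonneg_right (le_abs_self (u - v)) (Real.exp_pos u).le
    have h5 := mul_nonneg (abs_nonneg (u - v)) (Real.exp_pos v).le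
    linarith
  have hab : |(-a * x) - (-b * x)| = |a - b| * x := by
    rw [show (-a * x) - (-b * x) = -((a - b) * x) by ring, abs_neg, abs_mul, abs_of_pos hx]
  have k1 := key (-a * x) (-b * x)
  have k2 := key (-b * x) (-a * x)
  rw [abs_sub_comm] at k2
  rw [hab] at k1 k2
  rw [abs_div, abs_of_pos hx, div_le_iff₀ hx, abs_le]
  constructor <;> nlinarith

lemma integrableOn_exp_neg_mul_sub_div {a b : ℝ} (ha : 0 < a) (hb : 0 < b) :
    IntegrableOn (fun x => (Real.exp (-a * x) - Real.exp (-b * x)) / x) (Set.Ioi 0) := by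
  refine Integrable.mono' (((exp_neg_integrableOn_Ioi 0 ha).add
    (exp_neg_integrableOn_Ioi 0 hb)).const_mul |a - b|)
    (Measurable.aestronglyMeasurable (by fun_prop)) ?_
  filter_upwards [ae_restrict_mem measurableSet_Ioi] with x hx
  exact abs_exp_neg_mul_sub_le a b hx

lemma integral_exp_neg_mul_sub_div {a b : ℝ} (ha : 0 < a) (hb : 0 < b) :
    ∫ x in Set.Ioi (0 : ℝ), (Real.exp (-a * x) - Real.exp (-b * x)) / x =
      Real.log (b / a) := by
  have hE : (fun x : ℝ => x⁻¹ • (Real.exp (-(a * x)) - Real.exp (-(b * x)))) =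
      fun x => (Real.exp (-a * x) - Real.exp (-b * x)) / x := by
    funext x
    rw [smul_eq_mul, neg_mul, neg_mul, div_eq_inv_mul]
  have h := Frullani.integral_Ioi_eq (f := fun x : ℝ => Real.exp (-x)) (L := 1) (R := 0)
    ((by fun_prop : Continuous fun x : ℝ => Real.exp (-x)).locallyIntegrable.locallyIntegrableOn _)
    ha hb
    (tendsto_nhdsWithin_of_tendsto_nhds (Continuous.tendsto' (by fun_prop) _ _ (by simp)))
    (Real.tendsto_exp_atBot.comp Filter.tendsto_neg_atTop_atBot)
    (by simpa only [hE] using integrableOn_exp_neg_mul_sub_div ha hb)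
  rw [hE] at h
  simpa using h

lemma integral_exp_neg_mul_Ioi_zero {c : ℝ} (hc : 0 < c) :
    ∫ x in Set.Ioi (0 : ℝ), Real.exp (-c * x) = 1 / c := by
  rw [integral_exp_mul_Ioi (neg_lt_zero.mpr hc)]
  simp

lemma integrableOn_binetKernel_mul_exp {t : ℝ} (ht : 0 < t) :
    IntegrableOn (fun x => binetKernel x * Real.exp (-t * x)) (Set.Ioi 0) := by
  refine Integrable.mono' (exp_neg_integrableOn_Ioi 0 ht)
    (measurable_binetKernel.mul (by fun_prop)).aestronglyMeasurable ?_
  filter_upwards [ae_restrict_mem measurableSet_Ioi] with x hx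
  rw [Real.norm_eq_abs, abs_mul, Real.abs_exp]
  exact mul_le_of_le_one_left (Real.exp_pos _).le (abs_binetKernel_le_one hx)

lemma abs_integral_binetKernel_mul_exp_le {t : ℝ} (ht : 0 < t) :
    |∫ x in Set.Ioi (0 : ℝ), binetKernel x * Real.exp (-t * x)| ≤ 1 / t := by
  rw [← integral_exp_neg_mul_Ioi_zero ht, ← Real.norm_eq_abs]
  refine norm_integral_le_of_norm_le (exp_neg_integrableOn_Ioi 0 ht) ?_
  filter_upwards [ae_restrict_mem measurableSet_Ioi] with x hx
  rw [Real.norm_eq_abs, abs_mul, Real.abs_exp]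
  exact mul_le_of_le_one_left (Real.exp_pos _).le (abs_binetKernel_le_one hx)

lemma integral_binetKernel_mul_exp_sub {t : ℝ} (ht : 0 < t) :
    (∫ x in Set.Ioi (0 : ℝ), binetKernel x * Real.exp (-t * x)) -
      ∫ x in Set.Ioi (0 : ℝ), binetKernel x * Real.exp (-(t + 1) * x) =
      1 / (t + 1) - Real.log ((t + 1) / t) := by
  have ht1 : 0 < t + 1 := by linarith
  rw [← integral_exp_neg_mul_Ioi_zero ht1, ← integral_exp_neg_mul_sub_div ht ht1,
    ← integral_sub (integrableOn_binetKernel_mul_exp ht) (integrableOn_binetKernel_mul_exp ht1),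
    ← integral_sub (exp_neg_integrableOn_Ioi 0 ht1) (integrableOn_exp_neg_mul_sub_div ht ht1)]
  refine setIntegral_congr_fun measurableSet_Ioi fun x (hx : 0 < x) => ?_
  have h0 : Real.exp x - 1 ≠ 0 := by
    have := Real.add_one_lt_exp hx.ne'
    linarith
  have h1 : Real.exp (-t * x) = Real.exp (-(t + 1) * x) * Real.exp x := by
    rw [← Real.exp_add]; ring_nf
  simp only [binetKernel]
  rw [h1]
  field_simp

lemma hasDerivAt_integral_binetKernel {t : ℝ} (ht : 0 < t) :
    HasDerivAt (fun s => ∫ x in Set.Ioi (0 : ℝ),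
        binetKernel x * ((Real.exp (-x) - Real.exp (-s * x)) / x))
      (∫ x in Set.Ioi (0 : ℝ), binetKernel x * Real.exp (-t * x)) t := by
  have hmeas : ∀ s : ℝ, AEStronglyMeasurable
      (fun x => binetKernel x * ((Real.exp (-x) - Real.exp (-s * x)) / x))
      (volume.restrict (Set.Ioi 0)) := fun s =>
    (measurable_binetKernel.mul (by fun_prop)).aestronglyMeasurable
  refine (hasDerivAt_integral_of_dominated_loc_of_deriv_le (s := Set.Ioi (t / 2))
    (bound := fun x => Real.exp (-(t / 2) * x))
    (F' := fun s x => binetKernel x * Real.exp (-s * x))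
    (Ioi_mem_nhds (by linarith)) (Filter.Eventually.of_forall hmeas) ?_
    (integrableOn_binetKernel_mul_exp ht).aestronglyMeasurable ?_
    (exp_neg_integrableOn_Ioi 0 (by linarith)) ?_).2
  · refine Integrable.mono' (integrableOn_exp_neg_mul_sub_div one_pos ht).norm (hmeas t) ?_
    filter_upwards [ae_restrict_mem measurableSet_Ioi] with x hx
    rw [norm_mul, neg_one_mul]
    exact mul_le_of_le_one_left (norm_nonneg _) (abs_binetKernel_le_one hx)
  · filter_upwards [ae_restrict_mem measurableSet_Ioi] with x (hx : 0 < x) s (hs : t / 2 < s)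
    rw [Real.norm_eq_abs, abs_mul, Real.abs_exp]
    refine (mul_le_of_le_one_left (Real.exp_pos _).le (abs_binetKernel_le_one hx)).trans ?_
    exact Real.exp_le_exp.mpr (by nlinarith)
  · filter_upwards [ae_restrict_mem measurableSet_Ioi] with x (hx : 0 < x) s _
    have h1 : HasDerivAt (fun s : ℝ => -s * x) (-1 * x) s := (hasDerivAt_id s).neg.mul_const x
    have h2 := (((h1.exp).const_sub (Real.exp (-x))).div_const x).const_mul (binetKernel x)
    refine h2.congr_deriv ?_
    field_simp

lemma hasDerivAt_log_Gamma {s : ℝ} (hs : 0 < s) :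
    HasDerivAt (Real.log ∘ Real.Gamma) (deriv (Real.log ∘ Real.Gamma) s) s :=
  ((Real.differentiableAt_log (Real.Gamma_pos_of_pos hs).ne').comp s
    (Real.differentiableOn_Gamma_Ioi.differentiableAt (Ioi_mem_nhds hs))).hasDerivAt

lemma log_Gamma_add_one {s : ℝ} (hs : 0 < s) :
    Real.log (Real.Gamma (s + 1)) = Real.log s + Real.log (Real.Gamma s) := by
  rw [Real.Gamma_add_one hs.ne', Real.log_mul hs.ne' (Real.Gamma_pos_of_pos hs).ne']

lemma deriv_log_Gamma_add_one {s : ℝ} (hs : 0 < s) :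
    deriv (Real.log ∘ Real.Gamma) (s + 1) = deriv (Real.log ∘ Real.Gamma) s + 1 / s := by
  have h1 := (hasDerivAt_log_Gamma (add_pos hs one_pos)).comp_add_const s 1
  have h2 := (Real.hasDerivAt_log hs.ne').add (hasDerivAt_log_Gamma hs)
  have h3 := h2.congr_of_eventuallyEq (f₁ := fun x => (Real.log ∘ Real.Gamma) (x + 1)) (by
    filter_upwards [Ioi_mem_nhds hs] with x hx
    exact log_Gamma_add_one hx)
  rw [h1.unique h3, one_div, add_comm]

lemma slope_log_Gamma {s : ℝ} (hs : 0 < s) :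
    slope (Real.log ∘ Real.Gamma) s (s + 1) = Real.log s := by
  simp [slope_def_field, log_Gamma_add_one hs]

lemma deriv_log_Gamma_le_log {s : ℝ} (hs : 0 < s) :
    deriv (Real.log ∘ Real.Gamma) s ≤ Real.log s := by
  rw [← slope_log_Gamma hs]
  exact Real.convexOn_log_Gamma.le_slope_of_hasDerivAt hs (add_pos hs one_pos) (by linarith)
    (hasDerivAt_log_Gamma hs)

lemma log_le_deriv_log_Gamma_add_one {s : ℝ} (hs : 0 < s) :
    Real.log s ≤ deriv (Real.log ∘ Real.Gamma) (s + 1) := by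
  rw [← slope_log_Gamma hs]
  exact Real.convexOn_log_Gamma.slope_le_of_hasDerivAt hs (add_pos hs one_pos) (by linarith)
    (hasDerivAt_log_Gamma (add_pos hs one_pos))

lemma abs_log_sub_deriv_log_Gamma_le {s : ℝ} (hs : 0 < s) :
    |Real.log s - deriv (Real.log ∘ Real.Gamma) (s + 1)| ≤ 1 / s := by
  have h1 := log_le_deriv_log_Gamma_add_one hs
  have h2 := deriv_log_Gamma_le_log (add_pos hs one_pos)
  have h3 := Real.log_le_sub_one_of_pos (div_pos (add_pos hs one_pos) hs)
  rw [Real.log_div (add_pos hs one_pos).ne' hs.ne', add_div, div_self hs.ne'] at h3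
  rw [abs_le]
  constructor <;> linarith [one_div_pos.mpr hs]

/-- A function on `(0, ∞)` which is `1`-periodic and `O(1 / t)` vanishes. -/
lemma eq_zero_of_periodic_of_abs_le_s8 {H : ℝ → ℝ} {C : ℝ}
    (hper : ∀ s, 0 < s → H (s + 1) = H s) (hbound : ∀ s, 0 < s → |H s| ≤ C / s)
    {t : ℝ} (ht : 0 < t) : H t = 0 := by
  have hn : ∀ n : ℕ, H (t + n) = H t := by
    intro n
    induction n with
    | zero => simp
    | succ k ih =>
      rw [← ih, ← hper (t + k) (by positivity)]
      push_cast
      ring_nf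
  have hlim : Filter.Tendsto (fun n : ℕ => C / (t + n)) Filter.atTop (nhds 0) :=
    (Filter.tendsto_atTop_add_const_left _ t tendsto_natCast_atTop_atTop).const_div_atTop C
  have h := ge_of_tendsto' hlim fun n => (hn n ▸ hbound (t + n) (by positivity) :
    |H t| ≤ C / (t + n))
  exact abs_nonpos_iff.mp h

/-- **Binet's first formula** for the derivative of `log Γ`. -/
lemma integral_binetKernel_mul_exp {t : ℝ} (ht : 0 < t) :
    ∫ x in Set.Ioi (0 : ℝ), binetKernel x * Real.exp (-t * x) =
      Real.log t - deriv (Real.log ∘ Real.Gamma) (t + 1) := by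
  refine (sub_eq_zero.mp (eq_zero_of_periodic_of_abs_le_s8 (C := 2)
    (H := fun s => (Real.log s - deriv (Real.log ∘ Real.Gamma) (s + 1)) -
      ∫ x in Set.Ioi (0 : ℝ), binetKernel x * Real.exp (-s * x)) ?_ ?_ ht)).symm
  · intro s hs
    have hs1 : 0 < s + 1 := by linarith
    have h1 := integral_binetKernel_mul_exp_sub hs
    rw [Real.log_div hs1.ne' hs.ne'] at h1
    have h2 := deriv_log_Gamma_add_one hs1
    linarith
  · intro s hs
    refine (abs_sub _ _).trans ?_
    rw [show (2 : ℝ) / s = 1 / s + 1 / s by ring]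
    exact add_le_add (abs_log_sub_deriv_log_Gamma_le hs) (abs_integral_binetKernel_mul_exp_le hs)

theorem stmt_8 (t : ℝ) (ht : 0 < t) :
    ∫ x in Set.Ioi (0 : ℝ),
        (1 / (Real.exp x - 1) - 1 / x) * ((Real.exp (-x) - Real.exp (-t * x)) / x) =
      t * Real.log t - t + 1 - Real.log (Real.Gamma (1 + t)) := by
  have hderiv : ∀ s ∈ Set.Ioi (0 : ℝ), HasDerivAt
      (fun s => (∫ x in Set.Ioi (0 : ℝ),
          binetKernel x * ((Real.exp (-x) - Real.exp (-s * x)) / x)) -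
        (s * Real.log s - s + 1 - Real.log (Real.Gamma (s + 1)))) 0 s := by
    intro s hs
    have hs' : 0 < s := hs
    have h1 := ((((hasDerivAt_id s).mul (Real.hasDerivAt_log hs'.ne')).sub
      (hasDerivAt_id s)).add_const 1).sub
      ((hasDerivAt_log_Gamma (add_pos hs' one_pos)).comp_add_const s 1)
    have h2 := (hasDerivAt_integral_binetKernel hs').sub h1
    refine h2.congr_deriv ?_
    rw [integral_binetKernel_mul_exp hs']
    simp only [id]
    field_simp
    ring
  have hconst := isOpen_Ioi.is_const_of_deriv_eq_zero isPreconnected_Ioi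
    (fun s hs => (hderiv s hs).differentiableAt.differentiableWithinAt)
    (fun s hs => (hderiv s hs).deriv) (Set.mem_Ioi.mpr ht) (Set.mem_Ioi.mpr one_pos)
  rw [add_comm 1 t]
  refine sub_eq_zero.mp (hconst.trans ?_)
  norm_num [Real.Gamma_two]
end

section
/- For every natural number n, the integral ∫₀^1 [1/(1-y) + 1/log y] · (log|log y|)^n dy has the sign (-1)^n; that is, (-1)^n · ∫₀^1 [1/(1-y) + 1/log y] · (log|log y|)^n dy > 0. -/
open Real

open Set MeasureTheory

theorem integral_pow_mul_exp_neg_mul_Ioi (n : ℕ) {b : ℝ} (hb : 0 < b) :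
    ∫ u in Ioi (0 : ℝ), u ^ n * exp (-(b * u)) = n.factorial / b ^ (n + 1) := by
  have key := Real.integral_rpow_mul_exp_neg_mul_Ioi (a := (n : ℝ) + 1) (by positivity) hb
  rw [Real.Gamma_nat_eq_factorial] at key
  simp only [add_sub_cancel_right, rpow_natCast] at key
  rw [key]
  norm_cast
  rw [one_div, inv_pow]
  field_simp

theorem integrableOn_pow_mul_exp_neg_mul_Ioi (n : ℕ) {b : ℝ} (hb : 0 < b) :
    IntegrableOn (fun u : ℝ => u ^ n * exp (-(b * u))) (Ioi 0) :=
  .of_integral_ne_zero (by rw [integral_pow_mul_exp_neg_mul_Ioi n hb]; positivity)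

/-- The weight `1 / (1 - y) + 1 / log y` multiplied by the Jacobian of `y = exp (-exp u)`. -/
noncomputable def doubleExpWeight (u : ℝ) : ℝ :=
  exp (-exp u) * exp u * (1 / (1 - exp (-exp u)) - 1 / exp u)

theorem measurable_doubleExpWeight : Measurable doubleExpWeight := by
  unfold doubleExpWeight
  fun_prop

theorem one_div_one_sub_exp_neg_sub_le_one {t : ℝ} (ht : 0 < t) :
    1 / (1 - exp (-t)) - 1 / t ≤ 1 := by
  have h1 : 0 < 1 - exp (-t) := by
    have := exp_lt_one_iff.2 (neg_lt_zero.2 ht)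
    linarith
  have h2 : exp (-t) * (1 + t) ≤ 1 := by
    have h3 : t + 1 ≤ exp t := add_one_le_exp t
    have h4 : exp (-t) * exp t = 1 := by rw [← exp_add]; simp
    nlinarith [exp_pos (-t)]
  rw [div_sub_div _ _ h1.ne' ht.ne', div_le_one (by positivity)]
  nlinarith

theorem half_le_one_div_one_sub_exp_neg_sub {t : ℝ} (ht : 0 < t) :
    1 / 2 ≤ 1 / (1 - exp (-t)) - 1 / t := by
  have h1 : 0 < 1 - exp (-t) := by
    have := exp_lt_one_iff.2 (neg_lt_zero.2 ht)
    linarith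
  have hd : ∀ x : ℝ, HasDerivAt (fun x : ℝ => x * (1 + exp (-x)) + 2 * exp (-x))
      (1 - exp (-x) * (1 + x)) x := by
    intro x
    have he : HasDerivAt (fun x : ℝ => exp (-x)) (-exp (-x)) x := by
      simpa using (hasDerivAt_neg x).exp
    convert! ((hasDerivAt_id x).mul (he.const_add 1)).add (he.const_mul 2) using 1
    simp
    ring
  have hmono : Monotone (fun x : ℝ => x * (1 + exp (-x)) + 2 * exp (-x)) := by
    refine monotone_of_deriv_nonneg (fun x => (hd x).differentiableAt) fun x => ?_
    rw [(hd x).deriv]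
    have h3 : x + 1 ≤ exp x := add_one_le_exp x
    have h4 : exp (-x) * exp x = 1 := by rw [← exp_add]; simp
    nlinarith [exp_pos (-x)]
  have h := hmono ht.le
  simp only [neg_zero, exp_zero] at h
  rw [div_sub_div _ _ h1.ne' ht.ne', div_le_div_iff₀ (by norm_num) (by positivity)]
  nlinarith

theorem doubleExpWeight_nonneg (u : ℝ) : 0 ≤ doubleExpWeight u := by
  have := half_le_one_div_one_sub_exp_neg_sub (exp_pos u)
  unfold doubleExpWeight
  have h : 0 ≤ 1 / (1 - exp (-exp u)) - 1 / exp u := by linarith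
  positivity

theorem doubleExpWeight_le (u : ℝ) : doubleExpWeight u ≤ exp (-exp u) * exp u := by
  unfold doubleExpWeight
  exact mul_le_of_le_one_right (by positivity) (one_div_one_sub_exp_neg_sub_le_one (exp_pos u))

theorem doubleExpWeight_le_exp (u : ℝ) : doubleExpWeight u ≤ exp u := by
  refine (doubleExpWeight_le u).trans (mul_le_of_le_one_left (exp_pos u).le ?_)
  exact exp_le_one_iff.2 (neg_nonpos.2 (exp_pos u).le)

theorem pow_three_mul_exp_neg_le {t : ℝ} (ht : 0 ≤ t) : t ^ 3 * exp (-t) ≤ 7 / 5 := by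
  have h1 : t / 3 ≤ exp (t / 3 - 1) := by linarith [add_one_le_exp (t / 3 - 1)]
  have h2 : (t / 3) ^ 3 ≤ exp (t - 3) := by
    calc (t / 3) ^ 3 ≤ exp (t / 3 - 1) ^ 3 := by gcongr
      _ = exp (t - 3) := by rw [← exp_nat_mul]; congr 1; push_cast; ring
  have h3 : exp (t - 3) * exp (-t) * exp 1 ^ 3 = 1 := by
    rw [← exp_nat_mul, ← exp_add, ← exp_add, exp_eq_one_iff]
    push_cast
    ring
  have h4 : (27 : ℝ) / (7 / 5) ≤ exp 1 ^ 3 := by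
    have : (2.7 : ℝ) ≤ exp 1 := by linarith [exp_one_gt_d9]
    calc (27 : ℝ) / (7 / 5) ≤ 2.7 ^ 3 := by norm_num
      _ ≤ _ := by gcongr
  have h5 : t ^ 3 * exp (-t) ≤ 27 * (exp (t - 3) * exp (-t)) := by
    nlinarith [mul_le_mul_of_nonneg_right h2 (exp_pos (-t)).le]
  have h6 : 0 < exp (t - 3) * exp (-t) := by positivity
  nlinarith

theorem doubleExpWeight_le_exp_neg (u : ℝ) : doubleExpWeight u ≤ 7 / 5 * exp (-(2 * u)) := by
  refine (doubleExpWeight_le u).trans ?_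
  have h := pow_three_mul_exp_neg_le (exp_pos u).le
  have h2 : exp u = exp u ^ 3 * exp (-(2 * u)) := by
    rw [← exp_nat_mul, ← exp_add]
    congr 1
    push_cast
    ring
  calc exp (-exp u) * exp u = exp u ^ 3 * exp (-exp u) * exp (-(2 * u)) := by
        linear_combination exp (-exp u) * h2
    _ ≤ _ := by gcongr

theorem le_doubleExpWeight (u : ℝ) : (exp u - exp (2 * u)) / 2 ≤ doubleExpWeight u := by
  have h1 := half_le_one_div_one_sub_exp_neg_sub (exp_pos u)
  have h2 : 1 - exp u ≤ exp (-exp u) := one_sub_le_exp_neg _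
  have h3 : exp (2 * u) = exp u * exp u := by rw [← exp_add, two_mul]
  calc (exp u - exp (2 * u)) / 2 = (1 - exp u) * exp u * (1 / 2) := by rw [h3]; ring
    _ ≤ exp (-exp u) * exp u * (1 / 2) := by gcongr
    _ ≤ doubleExpWeight u := by unfold doubleExpWeight; gcongr

theorem image_exp_neg_exp : (fun u : ℝ => exp (-exp u)) '' univ = Ioo 0 1 := by
  ext y
  simp only [image_univ, mem_range, mem_Ioo]
  constructor
  · rintro ⟨u, rfl⟩
    exact ⟨exp_pos _, exp_lt_one_iff.2 (neg_lt_zero.2 (exp_pos u))⟩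
  · rintro ⟨h0, h1⟩
    refine ⟨log (-log y), ?_⟩
    rw [exp_log (neg_pos.2 (log_neg h0 h1)), neg_neg, exp_log h0]

theorem integral_eq_integral_doubleExpWeight (n : ℕ) :
    ∫ y in (0 : ℝ)..1, (1 / (1 - y) + 1 / log y) * log |log y| ^ n =
      ∫ u, doubleExpWeight u * u ^ n := by
  rw [intervalIntegral.integral_of_le zero_le_one, integral_Ioc_eq_integral_Ioo,
    ← image_exp_neg_exp, integral_image_eq_integral_abs_deriv_smul
      (f' := fun u => exp (-exp u) * -exp u) MeasurableSet.univ, setIntegral_univ]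
  · congr 1 with u
    simp only [doubleExpWeight, log_exp, abs_neg, abs_exp, abs_mul, smul_eq_mul]
    ring
  · exact fun u _ => ((hasDerivAt_exp u).neg.exp).hasDerivWithinAt
  · intro u _ v _ h
    simpa using h

theorem integrableOn_doubleExpWeight_mul_pow (n : ℕ) :
    IntegrableOn (fun u => doubleExpWeight u * u ^ n) (Ioi 0) := by
  refine Integrable.mono' ((integrableOn_pow_mul_exp_neg_mul_Ioi n two_pos).const_mul (7 / 5))
    (measurable_doubleExpWeight.mul (by fun_prop)).aestronglyMeasurable ?_
  refine (ae_restrict_iff' measurableSet_Ioi).2 (.of_forall fun u (hu : 0 < u) => ?_)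
  have h0 := doubleExpWeight_nonneg u
  rw [norm_of_nonneg (by positivity)]
  calc doubleExpWeight u * u ^ n ≤ 7 / 5 * exp (-(2 * u)) * u ^ n := by
        gcongr
        exact doubleExpWeight_le_exp_neg u
    _ = _ := by ring

theorem integrableOn_doubleExpWeight_neg_mul_pow (n : ℕ) :
    IntegrableOn (fun u => doubleExpWeight (-u) * u ^ n) (Ioi 0) := by
  refine Integrable.mono' (integrableOn_pow_mul_exp_neg_mul_Ioi n one_pos)
    ((measurable_doubleExpWeight.comp measurable_neg).mul (by fun_prop)).aestronglyMeasurable ?_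
  refine (ae_restrict_iff' measurableSet_Ioi).2 (.of_forall fun u (hu : 0 < u) => ?_)
  have h0 := doubleExpWeight_nonneg (-u)
  rw [norm_of_nonneg (by positivity), one_mul, mul_comm]
  gcongr
  exact doubleExpWeight_le_exp (-u)

theorem integral_doubleExpWeight_mul_pow (n : ℕ) :
    ∫ u, doubleExpWeight u * u ^ n =
      (-1) ^ n * (∫ u in Ioi 0, doubleExpWeight (-u) * u ^ n) +
        ∫ u in Ioi 0, doubleExpWeight u * u ^ n := by
  have hfun : (fun u : ℝ => doubleExpWeight (-u) * (-u) ^ n) =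
      fun u => (-1) ^ n * (doubleExpWeight (-u) * u ^ n) := by
    ext u
    rw [neg_pow u n]
    ring
  have hint : IntegrableOn (fun u => doubleExpWeight u * u ^ n) (Iic 0) := by
    have h : IntegrableOn (fun u => doubleExpWeight (-u) * (-u) ^ n) (Ici 0) := by
      rw [hfun, integrableOn_Ici_iff_integrableOn_Ioi]
      exact (integrableOn_doubleExpWeight_neg_mul_pow n).const_mul _
    simpa using h.comp_neg
  rw [← intervalIntegral.integral_Iic_add_Ioi hint (integrableOn_doubleExpWeight_mul_pow n)]
  congr 1
  have h := integral_comp_neg_Ioi (0 : ℝ) (fun u => doubleExpWeight u * u ^ n)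
  rw [neg_zero] at h
  rw [← h, hfun, integral_const_mul]

theorem integral_doubleExpWeight_mul_pow_le (n : ℕ) :
    ∫ u in Ioi 0, doubleExpWeight u * u ^ n ≤ 7 / 5 * (n.factorial / 2 ^ (n + 1)) := by
  rw [← integral_pow_mul_exp_neg_mul_Ioi n two_pos, ← integral_const_mul]
  refine setIntegral_mono_on (integrableOn_doubleExpWeight_mul_pow n)
    ((integrableOn_pow_mul_exp_neg_mul_Ioi n two_pos).const_mul _) measurableSet_Ioi
    fun u (hu : 0 < u) => ?_
  calc doubleExpWeight u * u ^ n ≤ 7 / 5 * exp (-(2 * u)) * u ^ n := by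
        gcongr
        exact doubleExpWeight_le_exp_neg u
    _ = _ := by ring

theorem le_integral_doubleExpWeight_neg_mul_pow (n : ℕ) :
    (n.factorial - n.factorial / 2 ^ (n + 1) : ℝ) / 2 ≤
      ∫ u in Ioi 0, doubleExpWeight (-u) * u ^ n := by
  have i1 := integrableOn_pow_mul_exp_neg_mul_Ioi n one_pos
  have i2 := integrableOn_pow_mul_exp_neg_mul_Ioi n two_pos
  have e1 := integral_pow_mul_exp_neg_mul_Ioi n one_pos
  rw [one_pow, div_one] at e1
  rw [← integral_pow_mul_exp_neg_mul_Ioi n two_pos, ← e1, ← integral_sub i1 i2,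
    ← integral_div]
  refine setIntegral_mono_on ((i1.sub i2).div_const 2)
    (integrableOn_doubleExpWeight_neg_mul_pow n) measurableSet_Ioi fun u (hu : 0 < u) => ?_
  have h := le_doubleExpWeight (-u)
  rw [mul_neg] at h
  calc (u ^ n * exp (-(1 * u)) - u ^ n * exp (-(2 * u))) / 2
      = (exp (-u) - exp (-(2 * u))) / 2 * u ^ n := by rw [one_mul]; ring
    _ ≤ _ := by gcongr

theorem stmt_15 (n : ℕ) :
    0 < (-1 : ℝ) ^ n *
        ∫ y in (0 : ℝ)..1,
          (1 / (1 - y) + 1 / Real.log y) * Real.log |Real.log y| ^ n := by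
  rw [integral_eq_integral_doubleExpWeight, integral_doubleExpWeight_mul_pow]
  have hA := le_integral_doubleExpWeight_neg_mul_pow n
  have hB := integral_doubleExpWeight_mul_pow_le n
  have hB0 : 0 ≤ ∫ u in Ioi 0, doubleExpWeight u * u ^ n :=
    setIntegral_nonneg measurableSet_Ioi fun u (hu : 0 < u) =>
      mul_nonneg (doubleExpWeight_nonneg u) (by positivity)
  have hf : (0 : ℝ) < n.factorial := by positivity
  rcases n.even_or_odd with hn | hn
  · have h2 : (n.factorial : ℝ) / 2 ^ (n + 1) < n.factorial :=
      div_lt_self hf (one_lt_pow₀ one_lt_two n.succ_ne_zero)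
    rw [hn.neg_one_pow]
    linarith
  · have h2 : (n.factorial : ℝ) / 2 ^ (n + 1) ≤ n.factorial / 2 ^ 2 := by
      have := hn.pos
      gcongr
      · norm_num
      · omega
    rw [hn.neg_one_pow]
    linarith
end

section
/- For every natural number n, the n-th derivative of the Gamma function at 1 has the sign (-1)^n; equivalently, (-1)^n · ∫₀^∞ e^{-t} (log t)^n dt > 0. -/
open Real MeasureTheory Filter Asymptotics Topology

lemma isBigO_atTop_log_pow_smul_exp_neg (n : ℕ) (a : ℝ) :
    (fun t : ℝ => log t ^ n • (exp (-t) : ℂ)) =O[atTop] (· ^ (-a)) := by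
  induction n generalizing a with
  | zero =>
    simp only [pow_zero, one_smul]
    refine IsBigO.of_norm_left ?_
    have := (isLittleO_exp_neg_mul_rpow_atTop one_pos (-a)).isBigO
    convert this using 2
    simp [Complex.norm_exp]
  | succ n ih =>
    simpa only [pow_succ', mul_smul] using isBigO_rpow_top_log_smul (lt_add_one a) (ih (a + 1))

lemma isBigO_nhdsGT_zero_log_pow_smul_exp_neg (n : ℕ) {b : ℝ} (hb : 0 < b) :
    (fun t : ℝ => log t ^ n • (exp (-t) : ℂ)) =O[𝓝[>] 0] (· ^ (-b)) := by
  induction n generalizing b with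
  | zero =>
    simp only [pow_zero, one_smul]
    have h₁ : (fun t : ℝ => ((exp (-t) : ℝ) : ℂ)) =O[𝓝[>] 0] (fun _ => (1 : ℝ)) := by
      refine IsBigO.of_bound 1 ?_
      filter_upwards [self_mem_nhdsWithin] with t ht
      rw [Complex.norm_real, norm_of_nonneg (exp_pos _).le]
      simpa using (Set.mem_Ioi.mp ht).le
    refine h₁.trans (IsBigO.of_bound 1 ?_)
    filter_upwards [Ioo_mem_nhdsGT one_pos] with t ht
    rw [one_mul, norm_one, norm_of_nonneg (rpow_nonneg ht.1.le _)]
    exact one_le_rpow_of_pos_of_le_one_of_nonpos ht.1 ht.2.le (by linarith)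
  | succ n ih =>
    simpa only [pow_succ', mul_smul] using
      isBigO_rpow_zero_log_smul (half_lt_self hb) (ih (half_pos hb))

lemma mellin_log_pow_smul_exp_neg_hasDerivAt (n : ℕ) {s : ℂ} (hs : 0 < s.re) :
    MellinConvergent (fun t : ℝ => log t ^ (n + 1) • (exp (-t) : ℂ)) s ∧
      HasDerivAt (mellin fun t : ℝ => log t ^ n • (exp (-t) : ℂ))
        (mellin (fun t : ℝ => log t ^ (n + 1) • (exp (-t) : ℂ)) s) s := by
  have hc : LocallyIntegrableOn (fun t : ℝ => log t ^ n • (exp (-t) : ℂ)) (Set.Ioi 0) := by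
    refine ContinuousOn.locallyIntegrableOn ?_ measurableSet_Ioi
    refine ContinuousOn.smul ((continuousOn_log.mono fun t ht => ?_).pow n) (by fun_prop)
    exact (Set.mem_Ioi.mp ht).ne'
  simpa only [pow_succ', mul_smul] using mellin_hasDerivAt_of_isBigO_rpow hc
    (isBigO_atTop_log_pow_smul_exp_neg n (s.re + 1)) (lt_add_one _)
    (isBigO_nhdsGT_zero_log_pow_smul_exp_neg n (half_pos hs)) (half_lt_self hs)

lemma iteratedDeriv_Gamma_eq_mellin (n : ℕ) {x : ℝ} (hx : 0 < x) :
    iteratedDeriv n Gamma x = (mellin (fun t : ℝ => log t ^ n • (exp (-t) : ℂ)) x).re := by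
  induction n generalizing x with
  | zero =>
    rw [iteratedDeriv_zero, Gamma, Complex.Gamma_eq_integral (by simpa using hx),
      Complex.GammaIntegral_eq_mellin]
    simp
  | succ n ih =>
    rw [iteratedDeriv_succ]
    have h := (mellin_log_pow_smul_exp_neg_hasDerivAt n
      (s := (x : ℂ)) (by simpa using hx)).2.real_of_complex
    rw [← h.deriv]
    refine EventuallyEq.deriv_eq ?_
    filter_upwards [lt_mem_nhds hx] with y hy using ih hy

lemma iteratedDeriv_Gamma_one (n : ℕ) :
    iteratedDeriv n Gamma 1 = ∫ t in Set.Ioi (0 : ℝ), exp (-t) * log t ^ n := by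
  rw [iteratedDeriv_Gamma_eq_mellin n one_pos, ← Complex.ofReal_re (∫ t in _, _),
    ← integral_complex_ofReal]
  simp [mellin, mul_comm]

lemma integrableOn_exp_neg_mul_log_pow (n : ℕ) :
    IntegrableOn (fun t : ℝ => exp (-t) * log t ^ n) (Set.Ioi 0) := by
  cases n with
  | zero => simpa using integrableOn_exp_neg_Ioi 0
  | succ n =>
    have h := (mellin_log_pow_smul_exp_neg_hasDerivAt n (s := 1) (by simp)).1.re
    simpa [IntegrableOn, mul_comm, ← Complex.ofReal_exp, ← Complex.ofReal_neg, ← Complex.ofReal_pow] using h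

lemma exp_sub_exp_lt_exp_neg_sub_exp_neg {x : ℝ} (hx : 0 < x) :
    exp (x - exp x) < exp (-x - exp (-x)) := by
  have := self_lt_sinh_iff.mpr hx
  rw [sinh_eq] at this
  exact exp_lt_exp.mpr (by linarith)

lemma symm_pow_mul_exp_sub_exp_pos (n : ℕ) {x : ℝ} (hx : x ≠ 0) :
    0 < (-x) ^ n * exp (x - exp x) + x ^ n * exp (-x - exp (-x)) := by
  wlog h : 0 < x generalizing x
  · have := this (neg_ne_zero.mpr hx) (by grind)
    rw [neg_neg] at this
    linarith
  have hlt := exp_sub_exp_lt_exp_neg_sub_exp_neg h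
  have hp := pow_pos h n
  rcases n.even_or_odd with hn | hn
  · rw [hn.neg_pow]; positivity
  · rw [hn.neg_pow]; nlinarith

lemma image_exp_univ : exp '' Set.univ = Set.Ioi 0 := by
  rw [Set.image_univ, range_exp]

lemma neg_one_pow_mul_integral_exp_neg_mul_log_pow_pos (n : ℕ) :
    0 < (-1 : ℝ) ^ n * ∫ t in Set.Ioi (0 : ℝ), exp (-t) * log t ^ n := by
  have hd : ∀ x ∈ Set.univ, HasDerivWithinAt exp (exp x) Set.univ x :=
    fun x _ => (hasDerivAt_exp x).hasDerivWithinAt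
  set f : ℝ → ℝ := fun x => (-x) ^ n * exp (x - exp x) with hf
  have hfe (x : ℝ) : f x = (-1) ^ n * (|exp x| • (exp (-exp x) * log (exp x) ^ n)) := by
    simp only [hf, abs_exp, log_exp, smul_eq_mul, sub_eq_add_neg, exp_add, neg_pow x]
    ring
  have hfi : Integrable f := by
    have h := integrableOn_exp_neg_mul_log_pow n
    rw [← image_exp_univ, integrableOn_image_iff_integrableOn_abs_deriv_smul .univ hd
      exp_injective.injOn, integrableOn_univ] at h
    simpa only [← hfe] using h.const_mul ((-1) ^ n)
  have heq : (-1 : ℝ) ^ n * ∫ t in Set.Ioi (0 : ℝ), exp (-t) * log t ^ n = ∫ x, f x := by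
    rw [← image_exp_univ, integral_image_eq_integral_abs_deriv_smul .univ hd
      exp_injective.injOn, setIntegral_univ, ← integral_const_mul]
    simp only [hfe]
  have hpos (x : ℝ) (hx : x ≠ 0) : 0 < f x + f (-x) := by
    simpa [hf] using symm_pow_mul_exp_sub_exp_pos n hx
  have hsum : 0 < ∫ x, (f x + f (-x)) := by
    have hae : ∀ᵐ x : ℝ, x ≠ 0 := Measure.ae_ne volume 0
    rw [integral_pos_iff_support_of_nonneg_ae (hae.mono fun x hx => (hpos x hx).le)
      (hfi.add hfi.comp_neg)]
    refine lt_of_lt_of_le ?_ (measure_mono (s := Set.Ioi 0) fun x hx => ?_)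
    · simp
    · exact (hpos x (Set.mem_Ioi.mp hx).ne').ne'
  rw [integral_add hfi hfi.comp_neg, integral_neg_eq_self] at hsum
  rw [heq]
  linarith

theorem stmt_16 (n : ℕ) :
    0 < (-1 : ℝ) ^ n * iteratedDeriv n Real.Gamma 1 ∧
    0 < (-1 : ℝ) ^ n *
        ∫ t in Set.Ioi (0 : ℝ), Real.exp (-t) * Real.log t ^ n := by
  have h := neg_one_pow_mul_integral_exp_neg_mul_log_pow_pos n
  exact ⟨by rwa [iteratedDeriv_Gamma_one], h⟩
end

section
/- 2ζ(3) - γ·ζ(2) = ∫₀^1 [Li₂(t)/(t-1) - ζ(2)/log t] dt, where Li₂(t) = Σ_{n=1}^∞ t^n/n² is the dilogarithm, γ is the Euler–Mascheroni constant, and ζ is the Riemann zeta function. -/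
open Real Complex

open MeasureTheory Set Finset Filter Topology

/-- A telescoping series with antitone terms tending to zero. -/
lemma hasSum_sub_succ_of_antitone {f : ℕ → ℝ} (hf : Antitone f) (h0 : Tendsto f atTop (𝓝 0)) :
    HasSum (fun n ↦ f n - f (n + 1)) (f 0) := by
  rw [hasSum_iff_tendsto_nat_of_nonneg (fun n ↦ sub_nonneg.2 (hf n.le_succ))]
  simp_rw [Finset.sum_range_sub']
  simpa using h0.const_sub (f 0)

lemma hasSum_one_div_sub_one_div_add (m : ℕ) :
    HasSum (fun k : ℕ ↦ 1 / ((k : ℝ) + 1) - 1 / ((k : ℝ) + 1 + m))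
      (∑ i ∈ range m, 1 / ((i : ℝ) + 1)) := by
  induction m with
  | zero => simp
  | succ m ih =>
    rw [Finset.sum_range_succ]
    have h := hasSum_sub_succ_of_antitone (f := fun k : ℕ ↦ 1 / ((k : ℝ) + 1 + m))
      (fun a b hab ↦ by beta_reduce; gcongr) ?_
    · convert ih.add h using 1
      · ext k
        push_cast
        rw [show (k : ℝ) + 1 + (m + 1) = k + 1 + 1 + m by ring]
        ring
      · simp [add_comm]
    · refine squeeze_zero (fun k ↦ by positivity) (fun k ↦ ?_)
        tendsto_one_div_add_atTop_nhds_zero_nat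
      exact one_div_le_one_div_of_le (by positivity) (by linarith [(m.cast_nonneg : (0 : ℝ) ≤ m)])

lemma summable_one_div_mul_mul_add :
    Summable fun p : ℕ × ℕ ↦ 1 / (((p.1 : ℝ) + 1) * (p.2 + 1) * (p.1 + p.2 + 2)) := by
  have h : Summable fun n : ℕ ↦ 1 / ((n : ℝ) + 1) ^ (3 / 2 : ℝ) := by
    have := (summable_nat_add_iff 1).2
      (Real.summable_one_div_nat_rpow (p := 3 / 2).2 (by norm_num))
    simpa using this
  refine Summable.of_nonneg_of_le (fun p ↦ by positivity) (fun p ↦ ?_)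
    (h.mul_of_nonneg h (fun n ↦ by positivity) (fun n ↦ by positivity))
  obtain ⟨n, k⟩ := p
  have hx : (0 : ℝ) < n + 1 := by positivity
  have hy : (0 : ℝ) < k + 1 := by positivity
  have hpow : ∀ x : ℝ, 0 < x → x ^ (3 / 2 : ℝ) = x * √x := fun x hx ↦ by
    rw [show (3 / 2 : ℝ) = 1 + 1 / 2 by norm_num, rpow_add hx, rpow_one, sqrt_eq_rpow]
  simp only
  rw [hpow _ hx, hpow _ hy, one_div_mul_one_div]
  refine one_div_le_one_div_of_le (by positivity) ?_
  rw [mul_mul_mul_comm]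
  refine mul_le_mul_of_nonneg_left ?_ (by positivity)
  nlinarith [sq_nonneg (√((n : ℝ) + 1) - √((k : ℝ) + 1)), Real.sq_sqrt hx.le, Real.sq_sqrt hy.le,
    Real.sqrt_nonneg ((n : ℝ) + 1), Real.sqrt_nonneg ((k : ℝ) + 1)]

/-- Euler's evaluation `∑ Hₙ / n² = 2 ζ(3)`. -/
lemma hasSum_harmonic_div_sq :
    HasSum (fun n : ℕ ↦ (∑ i ∈ range (n + 1), 1 / ((i : ℝ) + 1)) / ((n : ℝ) + 1) ^ 2)
      (2 * ∑' n : ℕ, 1 / ((n : ℝ) + 1) ^ 3) := by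
  set a : ℕ × ℕ → ℝ := fun p ↦ 1 / (((p.1 : ℝ) + 1) * (p.2 + 1) * (p.1 + p.2 + 2)) with ha
  set b : ℕ × ℕ → ℝ := fun p ↦ 1 / (((p.1 : ℝ) + 1) * (p.1 + p.2 + 2) ^ 2) with hb
  set s : ℕ → ℝ := fun n ↦ (∑ i ∈ range (n + 1), 1 / ((i : ℝ) + 1)) / ((n : ℝ) + 1) ^ 2 with hs
  have ha_sum : Summable a := summable_one_div_mul_mul_add
  have hab : ∀ p, a p = b p + b p.swap := fun p ↦ by
    simp only [ha, hb, Prod.fst_swap, Prod.snd_swap]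
    rw [add_comm (p.2 : ℝ) p.1]
    field_simp
    ring
  have hb_sum : Summable b := by
    refine Summable.of_nonneg_of_le (fun p ↦ by positivity) (fun p ↦ ?_) ha_sum
    rw [hab]
    have : 0 ≤ b p.swap := by positivity
    linarith
  have ha_tsum : ∑' p, a p = 2 * ∑' p, b p := by
    have hswap : Summable fun p : ℕ × ℕ ↦ b p.swap := (Equiv.prodComm ℕ ℕ).summable_iff.2 hb_sum
    rw [tsum_congr hab, hb_sum.tsum_add hswap, two_mul]
    congr 1
    exact (Equiv.prodComm ℕ ℕ).tsum_eq b
  have hrow : ∀ n, HasSum (fun k ↦ a (n, k)) (s n) := fun n ↦ by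
    have := (hasSum_one_div_sub_one_div_add (n + 1)).div_const (((n : ℝ) + 1) ^ 2)
    refine (congrArg (HasSum · _) (funext fun k ↦ ?_)).mp this
    simp only [ha]
    push_cast
    rw [show (k : ℝ) + 1 + (n + 1) = n + k + 2 by ring]
    field_simp
    ring
  have hs_sum : HasSum s (∑' p, a p) := ha_sum.hasSum.prod_fiberwise hrow
  have hb_diag : HasSum (fun N : ℕ ↦ (∑ i ∈ range (N + 1), 1 / ((i : ℝ) + 1)) / ((N : ℝ) + 2) ^ 2)
      (∑' p, b p) := by
    have h := ((Finset.HasAntidiagonal.sigmaAntidiagonalEquivProd (A := ℕ)).hasSum_iff.2 hb_sum.hasSum).sigma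
      (fun N ↦ hasSum_fintype _)
    convert h using 1
    ext N
    rw [Finset.sum_div, ← Finset.Nat.sum_antidiagonal_eq_sum_range_succ_mk
      (fun p : ℕ × ℕ ↦ 1 / ((p.1 : ℝ) + 1) / ((N : ℝ) + 2) ^ 2), ← Finset.sum_coe_sort]
    refine Finset.sum_congr rfl fun p _ ↦ ?_
    have hp : (p.1.1 : ℝ) + p.1.2 = N := by
      exact_mod_cast Finset.HasAntidiagonal.mem_antidiagonal.1 p.2
    simp only [Function.comp, hb, Finset.HasAntidiagonal.sigmaAntidiagonalEquivProd_apply]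
    rw [hp, div_div]
  have hz : Summable fun n : ℕ ↦ 1 / ((n : ℝ) + 1) ^ 3 := by
    simpa using (summable_nat_add_iff 1).2 (Real.summable_one_div_nat_pow (p := 3).2 (by norm_num))
  have hshift : HasSum s (∑' p, b p + ∑' n : ℕ, 1 / ((n : ℝ) + 1) ^ 3) := by
    have h0 : HasSum (fun n : ℕ ↦ (∑ i ∈ range n, 1 / ((i : ℝ) + 1)) / ((n : ℝ) + 1) ^ 2)
        (∑' p, b p) := by
      rw [← hasSum_nat_add_iff' 1]
      simp only [Finset.sum_range_one, Finset.sum_range_zero, zero_div, sub_zero]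
      refine (congrArg (HasSum · _) (funext fun n ↦ ?_)).mp hb_diag
      push_cast
      rw [add_assoc (n : ℝ), one_add_one_eq_two]
    convert h0.add hz.hasSum using 1
    ext n
    simp only [hs, Finset.sum_range_succ]
    field_simp
  have := hs_sum.unique hshift
  convert hs_sum using 1
  linarith

lemma hasSum_eulerMascheroniConstant :
    HasSum (fun n : ℕ ↦ 1 / ((n : ℝ) + 1) - Real.log (((n : ℝ) + 2) / (n + 1)))
      eulerMascheroniConstant := by
  rw [hasSum_iff_tendsto_nat_of_nonneg]
  · convert tendsto_eulerMascheroniSeq using 1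
    ext n
    induction n with
    | zero => simp [eulerMascheroniSeq_zero]
    | succ n ih =>
      rw [Finset.sum_range_succ, ih, eulerMascheroniSeq, eulerMascheroniSeq, harmonic_succ,
        Real.log_div (by positivity) (by positivity)]
      push_cast
      rw [show (n : ℝ) + 1 + 1 = n + 2 by ring]
      ring
  · intro n
    have h := Real.log_le_sub_one_of_pos (x := ((n : ℝ) + 2) / (n + 1)) (by positivity)
    have : ((n : ℝ) + 2) / (n + 1) - 1 = 1 / (n + 1) := by field_simp; ring
    linarith

lemma integral_const_rpow_exponent {t : ℝ} (h0 : 0 < t) (h1 : t < 1) (n : ℕ) :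
    ∫ s in (n : ℝ)..(n + 1), t ^ s = (t ^ (n + 1) - t ^ n) / Real.log t := by
  have hlog : Real.log t ≠ 0 := (Real.log_neg h0 h1).ne
  rw [intervalIntegral.integral_eq_sub_of_hasDerivAt (f := fun s ↦ t ^ s / Real.log t)]
  · simp only [← sub_div]
    norm_cast
  · intro s _
    refine (((hasDerivAt_id s).const_rpow h0).div_const (Real.log t)).congr_deriv ?_
    rw [mul_one, id, mul_div_cancel_left₀ _ hlog]
  · exact (Real.continuous_const_rpow h0.ne').intervalIntegrable _ _

lemma integral_pow_succ_sub_pow_div_log (n : ℕ) :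
    ∫ t in Ioo (0 : ℝ) 1, (t ^ (n + 1) - t ^ n) / Real.log t
      = Real.log (((n : ℝ) + 2) / (n + 1)) := by
  have hn : (n : ℝ) ≤ n + 1 := by linarith
  have h1 : ∫ t in Ioo (0 : ℝ) 1, (t ^ (n + 1) - t ^ n) / Real.log t
      = ∫ t in Ioo (0 : ℝ) 1, ∫ s in Ioc (n : ℝ) (n + 1), t ^ s := by
    refine setIntegral_congr_fun measurableSet_Ioo fun t ht ↦ ?_
    rw [← integral_const_rpow_exponent ht.1 ht.2 n, intervalIntegral.integral_of_le hn]
  have hint : Integrable (Function.uncurry fun (t s : ℝ) ↦ t ^ s)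
      ((volume.restrict (Ioo (0 : ℝ) 1)).prod (volume.restrict (Ioc (n : ℝ) (n + 1)))) := by
    refine Integrable.of_bound (C := 1) (by
      unfold Function.uncurry
      exact (measurable_fst.pow measurable_snd).aestronglyMeasurable) ?_
    rw [Measure.prod_restrict]
    refine (ae_restrict_iff' (measurableSet_Ioo.prod measurableSet_Ioc)).2 (.of_forall ?_)
    rintro ⟨t, s⟩ ⟨ht, hs⟩
    have hs0 : 0 ≤ s := (n.cast_nonneg : (0 : ℝ) ≤ n).trans hs.1.le
    simp only [Function.uncurry]
    rw [Real.norm_of_nonneg (Real.rpow_nonneg ht.1.le _)]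
    exact Real.rpow_le_one ht.1.le ht.2.le hs0
  rw [h1, integral_integral_swap hint]
  have h2 : ∫ s in Ioc (n : ℝ) (n + 1), ∫ t in Ioo (0 : ℝ) 1, t ^ s
      = ∫ s in (n : ℝ)..(n + 1), (s + 1)⁻¹ := by
    rw [intervalIntegral.integral_of_le hn]
    refine setIntegral_congr_fun measurableSet_Ioc fun s hs ↦ ?_
    have hs0 : 0 ≤ s := (n.cast_nonneg : (0 : ℝ) ≤ n).trans hs.1.le
    rw [← integral_Ioc_eq_integral_Ioo, ← intervalIntegral.integral_of_le zero_le_one,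
      integral_rpow (Or.inl (by linarith)), Real.one_rpow, Real.zero_rpow (by linarith)]
    simp
  rw [h2, intervalIntegral.integral_comp_add_right (fun x ↦ x⁻¹),
    integral_inv_of_pos (by positivity) (by positivity)]
  ring_nf

lemma inv_log_add_inv_one_sub_mem_Icc {t : ℝ} (ht : t ∈ Ioo (0 : ℝ) 1) :
    1 / Real.log t + 1 / (1 - t) ∈ Icc (0 : ℝ) 1 := by
  have hlog := Real.log_neg ht.1 ht.2
  have h1 : Real.log t ≤ t - 1 := Real.log_le_sub_one_of_pos ht.1
  have h2 : 1 - t⁻¹ ≤ Real.log t := Real.one_sub_inv_le_log_of_pos ht.1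
  have hpos : 0 < 1 - t := by linarith [ht.2]
  have h3 : -(Real.log t * t) ≤ 1 - t := by
    have := mul_le_mul_of_nonneg_right h2 ht.1.le
    rw [sub_mul, inv_mul_cancel₀ ht.1.ne'] at this
    linarith
  have e : 1 / Real.log t + 1 / (1 - t)
      = (-Real.log t - (1 - t)) / (-Real.log t * (1 - t)) := by
    field_simp [hlog.ne]
    ring
  have hden : 0 < -Real.log t * (1 - t) := mul_pos (by linarith) hpos
  rw [e]
  refine ⟨div_nonneg (by linarith) hden.le, (div_le_one hden).2 ?_⟩
  linarith

lemma integrableOn_inv_log_add_inv_one_sub :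
    IntegrableOn (fun t : ℝ ↦ 1 / Real.log t + 1 / (1 - t)) (Ioo 0 1) := by
  refine Integrable.of_bound (C := 1) (by fun_prop) ?_
  refine (ae_restrict_iff' measurableSet_Ioo).2 (.of_forall fun t ht ↦ ?_)
  have := inv_log_add_inv_one_sub_mem_Icc ht
  rw [Real.norm_of_nonneg this.1]
  exact this.2

lemma integral_inv_log_add_inv_one_sub :
    ∫ t in Ioo (0 : ℝ) 1, (1 / Real.log t + 1 / (1 - t)) = eulerMascheroniConstant := by
  set F : ℕ → ℝ → ℝ := fun n t ↦ t ^ n - (t ^ (n + 1) - t ^ n) / Real.log t with hF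
  have hF_eq : ∀ n, ∀ t ∈ Ioo (0 : ℝ) 1,
      F n t = t ^ n * ((1 / Real.log t + 1 / (1 - t)) * (1 - t)) := fun n t ht ↦ by
    have h1 : Real.log t ≠ 0 := (Real.log_neg ht.1 ht.2).ne
    have h2 : 1 - t ≠ 0 := by linarith [ht.2]
    simp only [hF]
    field_simp
    ring
  have hF_mem : ∀ n, ∀ t ∈ Ioo (0 : ℝ) 1, 0 ≤ F n t ∧ F n t ≤ 1 := fun n t ht ↦ by
    have hA := inv_log_add_inv_one_sub_mem_Icc ht
    have h0 : 0 ≤ 1 - t := by linarith [ht.2]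
    rw [hF_eq n t ht]
    refine ⟨mul_nonneg (pow_nonneg ht.1.le _) (mul_nonneg hA.1 h0), ?_⟩
    exact mul_le_one₀ (pow_le_one₀ ht.1.le ht.2.le) (mul_nonneg hA.1 h0)
      (mul_le_one₀ hA.2 h0 (by linarith [ht.1]))
  have hF_int : ∀ n, IntegrableOn (F n) (Ioo 0 1) := fun n ↦ by
    refine Integrable.of_bound (C := 1) (by fun_prop) ?_
    refine (ae_restrict_iff' measurableSet_Ioo).2 (.of_forall fun t ht ↦ ?_)
    rw [Real.norm_of_nonneg (hF_mem n t ht).1]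
    exact (hF_mem n t ht).2
  have hpow : ∀ n : ℕ, IntegrableOn (fun t : ℝ ↦ t ^ n) (Ioo 0 1) := fun n ↦
    ((continuous_pow n).integrableOn_Icc).mono_set Ioo_subset_Icc_self
  have hF_val : ∀ n : ℕ, ∫ t in Ioo (0 : ℝ) 1, F n t
      = 1 / ((n : ℝ) + 1) - Real.log (((n : ℝ) + 2) / (n + 1)) := fun n ↦ by
    have hsub : IntegrableOn (fun t : ℝ ↦ (t ^ (n + 1) - t ^ n) / Real.log t) (Ioo 0 1) :=
      ((hpow n).sub (hF_int n)).congr (.of_forall fun t ↦ by simp [hF])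
    simp only [hF]
    rw [integral_sub (hpow n) hsub, integral_pow_succ_sub_pow_div_log,
      ← integral_Ioc_eq_integral_Ioo, ← intervalIntegral.integral_of_le zero_le_one, integral_pow]
    simp
  have hsum := hasSum_integral_of_summable_integral_norm (μ := volume.restrict (Ioo (0 : ℝ) 1))
    hF_int (by
      refine hasSum_eulerMascheroniConstant.summable.congr fun n ↦ ?_
      rw [← hF_val n]
      refine setIntegral_congr_fun measurableSet_Ioo fun t ht ↦ ?_
      exact (Real.norm_of_nonneg (hF_mem n t ht).1).symm)
  simp_rw [hF_val] at hsum
  rw [hasSum_eulerMascheroniConstant.unique hsum]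
  refine setIntegral_congr_fun measurableSet_Ioo fun t ht ↦ ?_
  have h2 : 1 - t ≠ 0 := by linarith [ht.2]
  rw [tsum_congr fun n ↦ hF_eq n t ht, tsum_mul_right, tsum_geometric_of_lt_one ht.1.le ht.2]
  field_simp

lemma integral_geom_sum (m : ℕ) :
    ∫ t in Ioo (0 : ℝ) 1, ∑ i ∈ range m, t ^ i = ∑ i ∈ range m, 1 / ((i : ℝ) + 1) := by
  rw [← integral_Ioc_eq_integral_Ioo, ← intervalIntegral.integral_of_le zero_le_one,
    intervalIntegral.integral_finsetSum fun i _ ↦ (continuous_pow i).intervalIntegrable _ _]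
  simp

lemma hasSum_one_div_succ_sq : HasSum (fun n : ℕ ↦ 1 / ((n : ℝ) + 1) ^ 2) (π ^ 2 / 6) := by
  have := (hasSum_nat_add_iff' 1).2 hasSum_zeta_two
  simpa using this

/-- The integral of the dilogarithm kernel, with all quantities real. -/
lemma integral_dilog_div_sub_zeta_two_div_log :
    ∫ t in Ioo (0 : ℝ) 1, ((∑' n : ℕ, t ^ (n + 1) / ((n : ℝ) + 1) ^ 2) / (t - 1)
        - (π ^ 2 / 6) / Real.log t)
      = 2 * ∑' n : ℕ, 1 / ((n : ℝ) + 1) ^ 3 - eulerMascheroniConstant * (π ^ 2 / 6) := by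
  set A : ℝ → ℝ := fun t ↦ 1 / Real.log t + 1 / (1 - t) with hA
  set G : ℕ → ℝ → ℝ := fun n t ↦ (∑ i ∈ range (n + 1), t ^ i) / ((n : ℝ) + 1) ^ 2 with hG
  have hgeom : ∀ n : ℕ, IntegrableOn (fun t : ℝ ↦ ∑ i ∈ range (n + 1), t ^ i) (Ioo 0 1) := fun n ↦
    (Continuous.integrableOn_Icc (by fun_prop)).mono_set Ioo_subset_Icc_self
  have hG_int : ∀ n, IntegrableOn (G n) (Ioo 0 1) := fun n ↦ (hgeom n).div_const _
  have hG_val : ∀ n : ℕ, ∫ t in Ioo (0 : ℝ) 1, G n t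
      = (∑ i ∈ range (n + 1), 1 / ((i : ℝ) + 1)) / ((n : ℝ) + 1) ^ 2 := fun n ↦ by
    simp only [hG]
    rw [integral_div, integral_geom_sum]
  set F : ℕ → ℝ → ℝ := fun n t ↦ G n t - A t * (1 / ((n : ℝ) + 1) ^ 2) with hF
  have hA_int : IntegrableOn A (Ioo 0 1) := integrableOn_inv_log_add_inv_one_sub
  have hF_int : ∀ n, IntegrableOn (F n) (Ioo 0 1) := fun n ↦ (hG_int n).sub (hA_int.mul_const _)
  have hF_norm : Summable fun n ↦ ∫ t in Ioo (0 : ℝ) 1, ‖F n t‖ := by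
    refine Summable.of_nonneg_of_le (fun n ↦ integral_nonneg fun t ↦ norm_nonneg _) (fun n ↦ ?_)
      (hasSum_harmonic_div_sq.add
        (hasSum_one_div_succ_sq.mul_left eulerMascheroniConstant)).summable
    rw [← hG_val n, ← integral_inv_log_add_inv_one_sub, ← integral_mul_const,
      ← integral_add (hG_int n) (hA_int.mul_const _)]
    refine setIntegral_mono_on (hF_int n).norm ((hG_int n).add (hA_int.mul_const _))
      measurableSet_Ioo fun t ht ↦ ?_
    have h1 : 0 ≤ G n t :=
      div_nonneg (Finset.sum_nonneg fun i _ ↦ pow_nonneg ht.1.le _) (by positivity)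
    have h2 : 0 ≤ A t * (1 / ((n : ℝ) + 1) ^ 2) :=
      mul_nonneg (inv_log_add_inv_one_sub_mem_Icc ht).1 (by positivity)
    refine (norm_sub_le _ _).trans_eq ?_
    rw [Real.norm_of_nonneg h1, Real.norm_of_nonneg h2]
  have hsum := hasSum_integral_of_summable_integral_norm hF_int hF_norm
  have hF_val : ∀ n : ℕ, ∫ t in Ioo (0 : ℝ) 1, F n t
      = (∑ i ∈ range (n + 1), 1 / ((i : ℝ) + 1)) / ((n : ℝ) + 1) ^ 2
        - eulerMascheroniConstant * (1 / ((n : ℝ) + 1) ^ 2) := fun n ↦ by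
    rw [← hG_val n, ← integral_inv_log_add_inv_one_sub, ← integral_mul_const,
      ← integral_sub (hG_int n) (hA_int.mul_const _)]
  simp_rw [hF_val] at hsum
  rw [(hasSum_harmonic_div_sq.sub
    (hasSum_one_div_succ_sq.mul_left eulerMascheroniConstant)).unique hsum]
  refine setIntegral_congr_fun measurableSet_Ioo fun t ht ↦ ?_
  have h1 : t - 1 ≠ 0 := by linarith [ht.2]
  have h2 : 1 - t ≠ 0 := by linarith [ht.2]
  have hlog : Real.log t ≠ 0 := (Real.log_neg ht.1 ht.2).ne
  have hLi : Summable fun n : ℕ ↦ t ^ (n + 1) / ((n : ℝ) + 1) ^ 2 := by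
    refine Summable.of_nonneg_of_le (fun n ↦ div_nonneg (pow_nonneg ht.1.le _) (by positivity))
      (fun n ↦ ?_) hasSum_one_div_succ_sq.summable
    gcongr
    exact pow_le_one₀ ht.1.le ht.2.le
  have h := (hLi.hasSum.div_const (t - 1)).sub (hasSum_one_div_succ_sq.div_const (Real.log t))
  rw [← h.tsum_eq]
  refine tsum_congr fun n ↦ ?_
  simp only [hF, hG, hA]
  rw [geom_sum_eq (by linarith [ht.2])]
  field_simp
  ring

theorem stmt_19 :
    2 * riemannZeta 3 -
        (Real.eulerMascheroniConstant : ℂ) * riemannZeta 2 =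
      Complex.ofReal
        (∫ t in (0 : ℝ)..1,
          ((∑' n : ℕ, t ^ (n + 1) / ((n : ℝ) + 1) ^ 2) / (t - 1) -
            (Real.pi ^ 2 / 6) / Real.log t)) := by
  have hz3 : riemannZeta 3 = ((∑' n : ℕ, 1 / ((n : ℝ) + 1) ^ 3 : ℝ) : ℂ) := by
    have h := zeta_eq_tsum_one_div_nat_add_one_cpow (s := 3) (by norm_num)
    rw [h]
    push_cast
    refine tsum_congr fun n ↦ ?_
    norm_cast
  rw [intervalIntegral.integral_of_le zero_le_one, integral_Ioc_eq_integral_Ioo,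
    integral_dilog_div_sub_zeta_two_div_log, riemannZeta_two, hz3]
  push_cast
  ring
end
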